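/- Let μ be a centered Gaussian measure on a real separable Banach space X and let f₁,…,f_n : X → [0,∞) be symmetric quasi-concave functions (i.e. f_i(-x) = f_i(x) and all super-level sets {f_i ≥ c} are convex). Then for any 1 ≤ m < n, (∫ ∏_{i=1}^m f_i dμ) · (∫ ∏_{j=m+1}^n f_j dμ) ≤ μ(X) · ∫ ∏_{i=1}^n f_i dμ. -/

import Mathlib

open MeasureTheory ProbabilityTheory

/-- A centered Gaussian (probability) measure on a real separable Banach space:
every continuous linear functional pushes it forward to a centered Gaussian on `ℝ`. -/
def IsCenteredGaussian {X : Type*} [NormedAddCommGroup X] [NormedSpace ℝ X]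
    [MeasurableSpace X] [BorelSpace X] (μ : Measure X) : Prop :=
  IsProbabilityMeasure μ ∧ ∀ L : X →L[ℝ] ℝ, ∃ v : NNReal, μ.map L = gaussianReal 0 v

/-! ### Gaussian integrals and Royen's inequality for slabs -/

/-- The standard Gaussian measure on `ι → ℝ`. -/
noncomputable abbrev stdPi (ι : Type*) [Fintype ι] : Measure (ι → ℝ) :=
  Measure.pi fun _ => gaussianReal 0 1

lemma integral_exp_neg_mul_sq_gaussianReal {k : ℝ} (hk : 0 ≤ k) :
    ∫ x, Real.exp (-(k * x ^ 2) / 2) ∂(gaussianReal 0 1) = (√(1 + k))⁻¹ := by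
  rw [integral_gaussianReal_eq_integral_smul one_ne_zero]
  have h : ∀ x : ℝ, gaussianPDFReal 0 1 x • Real.exp (-(k * x ^ 2) / 2)
      = (√(2 * Real.pi))⁻¹ * Real.exp (-((1 + k) / 2) * x ^ 2) := by
    intro x
    simp only [gaussianPDFReal, NNReal.coe_one, mul_one, sub_zero, smul_eq_mul]
    rw [mul_assoc, ← Real.exp_add]
    congr 2
    ring
  simp_rw [h]
  rw [integral_const_mul, integral_gaussian, ← Real.sqrt_inv, ← Real.sqrt_inv,
    ← Real.sqrt_mul (by positivity)]
  congr 1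
  have := Real.pi_pos
  field_simp

lemma Matrix.IsHermitian.det_one_add {ι : Type*} [Fintype ι] [DecidableEq ι] {Q : Matrix ι ι ℝ}
    (hQ : Q.IsHermitian) : (1 + Q).det = ∏ i, (1 + hQ.eigenvalues i) := by
  have h := congrArg (Polynomial.eval (-1)) hQ.charpoly_eq
  rw [Matrix.eval_charpoly, Polynomial.eval_prod] at h
  have h1 : (Matrix.scalar ι (-1 : ℝ) - Q) = -(1 + Q) := by
    rw [map_neg, map_one, neg_add, sub_eq_add_neg]
  have h2 : ∀ i, Polynomial.eval (-1) (Polynomial.X - Polynomial.C ((hQ.eigenvalues i : ℝ)))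
      = (-1) * (1 + hQ.eigenvalues i) := by
    intro i; simp; ring
  rw [h1, Matrix.det_neg] at h
  simp only [RCLike.ofReal_real_eq_id, id_eq, h2] at h
  rw [Finset.prod_mul_distrib] at h
  simpa using h

lemma integral_exp_neg_quadratic_stdPi {ι : Type*} [Fintype ι] [DecidableEq ι]
    {Q : Matrix ι ι ℝ} (hQ : Q.PosSemidef) :
    ∫ x, Real.exp (-(x ⬝ᵥ Q.mulVec x) / 2) ∂(stdPi ι) = (√((1 + Q).det))⁻¹ := by
  set b := hQ.1.eigenvectorBasis with hb
  have h1 := map_pi_eq_stdGaussian (ι := ι)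
  rw [stdGaussian_eq_map_pi_orthonormalBasis b] at h1
  have h2 : ∫ x, Real.exp (-(x ⬝ᵥ Q.mulVec x) / 2) ∂(stdPi ι)
      = ∫ x : EuclideanSpace ℝ ι, Real.exp (-(x.ofLp ⬝ᵥ Q.mulVec x.ofLp) / 2)
        ∂((stdPi ι).map (WithLp.toLp 2)) := by
    rw [integral_map]
    · fun_prop
    · apply Continuous.aestronglyMeasurable
      fun_prop
  have h3 : ∀ y : ι → ℝ, (∑ i, y i • b i).ofLp ⬝ᵥ Q.mulVec (∑ i, y i • b i).ofLp
      = ∑ i, hQ.1.eigenvalues i * y i ^ 2 := by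
    intro y
    have e1 : Q.mulVec (∑ i, y i • b i).ofLp = (∑ i, (y i * hQ.1.eigenvalues i) • b i).ofLp := by
      simp only [WithLp.ofLp_sum, WithLp.ofLp_smul, Matrix.mulVec_sum, Matrix.mulVec_smul]
      refine Finset.sum_congr rfl fun i _ => ?_
      rw [hb, hQ.1.mulVec_eigenvectorBasis, smul_smul]
    rw [e1]
    have e2 : ∀ u v : EuclideanSpace ℝ ι, u.ofLp ⬝ᵥ v.ofLp = inner ℝ v u := by
      intro u v
      simp [PiLp.inner_apply, dotProduct]
    rw [e2, b.orthonormal.inner_sum]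
    refine Finset.sum_congr rfl fun i _ => ?_
    simp; ring
  rw [h2, h1, integral_map]
  · simp_rw [h3]
    have h4 : ∀ y : ι → ℝ, Real.exp (-(∑ i, hQ.1.eigenvalues i * y i ^ 2) / 2)
        = ∏ i, Real.exp (-(hQ.1.eigenvalues i * y i ^ 2) / 2) := by
      intro y
      rw [← Real.exp_sum, ← Finset.sum_div, Finset.sum_neg_distrib]
    simp_rw [h4]
    rw [integral_fintype_prod_eq_prod (𝕜 := ℝ)
      (fun i (x : ℝ) => Real.exp (-(hQ.1.eigenvalues i * x ^ 2) / 2))]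
    simp_rw [integral_exp_neg_mul_sq_gaussianReal (hQ.eigenvalues_nonneg _)]
    rw [Finset.prod_inv_distrib, hQ.1.det_one_add, Real.sqrt_prod]
    intro i _
    have := hQ.eigenvalues_nonneg i
    linarith
  · exact (by fun_prop : Continuous fun x : ι → ℝ => ∑ i, x i • b i).measurable.aemeasurable
  · apply Continuous.aestronglyMeasurable
    fun_prop

lemma Matrix.PosSemidef.det_one_add_pos {ι : Type*} [Fintype ι] [DecidableEq ι]
    {Q : Matrix ι ι ℝ} (hQ : Q.PosSemidef) : 0 < (1 + Q).det :=
  (Matrix.PosDef.one.add_posSemidef hQ).det_pos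

/-- Scale by `θ` the entries of `C` joining indices with different labels. -/
def scaleCross {κ : Type*} (C : Matrix κ κ ℝ) (s : κ → Bool) (θ : ℝ) : Matrix κ κ ℝ :=
  Matrix.of fun i j => if s i = s j then C i j else θ * C i j

lemma scaleCross_eq {κ : Type*} [Fintype κ] [DecidableEq κ] (C : Matrix κ κ ℝ) (s : κ → Bool)
    (θ : ℝ) : scaleCross C s θ = ((1 + θ) / 2) • C + ((1 - θ) / 2) •
      (Matrix.diagonal (fun i => if s i then (1 : ℝ) else -1) * C *
        Matrix.diagonal (fun i => if s i then (1 : ℝ) else -1)) := by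
  ext i j
  simp only [scaleCross, Matrix.of_apply, Matrix.add_apply, Matrix.smul_apply,
    Matrix.mul_diagonal, Matrix.diagonal_mul, smul_eq_mul]
  cases s i <;> cases s j <;> simp <;> ring

lemma scaleCross_scaleCross {κ : Type*} (C : Matrix κ κ ℝ) (s : κ → Bool) (θ η : ℝ) :
    scaleCross (scaleCross C s θ) s η = scaleCross C s (η * θ) := by
  ext i j
  simp only [scaleCross, Matrix.of_apply]
  split_ifs <;> ring

lemma det_one_add_le_scaleCross {κ : Type*} [Fintype κ] [DecidableEq κ] {Q : Matrix κ κ ℝ}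
    (hQ : Q.PosSemidef) (s : κ → Bool) {θ : ℝ} (h0 : 0 ≤ θ) (h1 : θ ≤ 1) :
    (1 + Q).det ≤ (1 + scaleCross Q s θ).det := by
  set S : Matrix κ κ ℝ := Matrix.diagonal (fun i => if s i then (1 : ℝ) else -1) with hS
  have hSt : S.conjTranspose = S := by
    rw [hS, Matrix.diagonal_conjTranspose]
    simp
  have hSS : S * S = 1 := by
    rw [hS, Matrix.diagonal_mul_diagonal, ← Matrix.diagonal_one]
    congr 1
    ext i
    split_ifs <;> simp
  have hQ' : (S * Q * S).PosSemidef := by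
    have := hQ.mul_mul_conjTranspose_same S
    rwa [hSt] at this
  have hdet : (1 + S * Q * S).det = (1 + Q).det := by
    rw [mul_assoc, Matrix.det_one_add_mul_comm, mul_assoc, hSS, mul_one]
  have ha : 0 ≤ (1 + θ) / 2 := by linarith
  have hb : 0 ≤ (1 - θ) / 2 := by linarith
  have hI : (scaleCross Q s θ).PosSemidef := by
    rw [scaleCross_eq]
    exact (hQ.smul ha).add (hQ'.smul hb)
  have hint : ∀ {P : Matrix κ κ ℝ}, P.PosSemidef →
      Integrable (fun x => Real.exp (-(x ⬝ᵥ P.mulVec x) / 2)) (stdPi κ) := by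
    intro P hP
    refine Integrable.of_bound (C := 1) (by
      apply Continuous.aestronglyMeasurable
      fun_prop) (Filter.Eventually.of_forall fun x => ?_)
    rw [Real.norm_eq_abs, Real.abs_exp]
    have := hP.dotProduct_mulVec_nonneg x
    simp only [star_trivial] at this
    exact Real.exp_le_one_iff.2 (by linarith)
  have key : ∫ x, Real.exp (-(x ⬝ᵥ (scaleCross Q s θ).mulVec x) / 2) ∂(stdPi κ) ≤
      (1 + θ) / 2 * ∫ x, Real.exp (-(x ⬝ᵥ Q.mulVec x) / 2) ∂(stdPi κ) +
      (1 - θ) / 2 * ∫ x, Real.exp (-(x ⬝ᵥ (S * Q * S).mulVec x) / 2) ∂(stdPi κ) := by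
    rw [← integral_const_mul, ← integral_const_mul, ← integral_add]
    · refine integral_mono (hint hI) (((hint hQ).const_mul _).add ((hint hQ').const_mul _)) ?_
      intro x
      have := convexOn_exp.2 (Set.mem_univ (-(x ⬝ᵥ Q.mulVec x) / 2))
        (Set.mem_univ (-(x ⬝ᵥ (S * Q * S).mulVec x) / 2)) ha hb (by ring)
      simp only [smul_eq_mul] at this
      refine le_trans (le_of_eq ?_) this
      beta_reduce
      rw [scaleCross_eq, Matrix.add_mulVec, dotProduct_add, Matrix.smul_mulVec, Matrix.smul_mulVec,
        dotProduct_smul, dotProduct_smul, smul_eq_mul, smul_eq_mul]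
      congr 1
      ring
    · exact (hint hQ).const_mul _
    · exact (hint hQ').const_mul _
  rw [integral_exp_neg_quadratic_stdPi hI, integral_exp_neg_quadratic_stdPi hQ,
    integral_exp_neg_quadratic_stdPi hQ', hdet, ← add_mul] at key
  have e : (1 + θ) / 2 + (1 - θ) / 2 = 1 := by ring
  rw [e, one_mul] at key
  have := (inv_le_inv₀ (Real.sqrt_pos.2 hI.det_one_add_pos)
    (Real.sqrt_pos.2 hQ.det_one_add_pos)).1 key
  exact (Real.sqrt_le_sqrt_iff hI.det_one_add_pos.le).1 this

/-- The coefficient of `∏ i ∈ J, l i` in `det (1 + diagonal l * C)`. -/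
noncomputable def princCoeff {κ : Type*} [Fintype κ] [DecidableEq κ] (C : Matrix κ κ ℝ)
    (J : Finset κ) : ℝ :=
  Matrix.detRowAlternating (J.piecewise C.row (1 : Matrix κ κ ℝ).row)

lemma det_one_add_diagonal_mul {κ : Type*} [Fintype κ] [DecidableEq κ] (l : κ → ℝ)
    (C : Matrix κ κ ℝ) :
    (1 + Matrix.diagonal l * C).det = ∑ J : Finset κ, (∏ i ∈ J, l i) * princCoeff C J := by
  have h : (1 + Matrix.diagonal l * C).det
      = Matrix.detRowAlternating ((fun i => l i • C.row i) + (1 : Matrix κ κ ℝ).row) := by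
    rw [Matrix.detRowAlternating, Matrix.det]
    congr 1
    ext i j
    simp [add_comm]
  rw [h, AlternatingMap.map_add_univ]
  refine Finset.sum_congr rfl fun J _ => ?_
  have := Matrix.detRowAlternating.toMultilinearMap.map_piecewise_smul l
    (J.piecewise C.row (1 : Matrix κ κ ℝ).row) J
  rw [princCoeff, ← smul_eq_mul]
  refine Eq.trans ?_ this
  change Matrix.detRowAlternating _ = Matrix.detRowAlternating _
  congr 1
  ext i j
  by_cases hi : i ∈ J <;> simp [hi, Finset.piecewise]

lemma princCoeff_le_scaleCross {κ : Type*} [Fintype κ] [DecidableEq κ] {C : Matrix κ κ ℝ}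
    (hC : C.PosSemidef) (s : κ → Bool) {θ : ℝ} (h0 : 0 ≤ θ) (h1 : θ ≤ 1) (J : Finset κ) :
    princCoeff C J ≤ princCoeff (scaleCross C s θ) J := by
  have hdet : ∀ l : κ → ℝ, (∀ i, 0 ≤ l i) → (1 + Matrix.diagonal l * C).det ≤
      (1 + Matrix.diagonal l * scaleCross C s θ).det := by
    intro l hl
    set R : Matrix κ κ ℝ := Matrix.diagonal fun i => √(l i) with hR
    have hRR : Matrix.diagonal l = R * R := by
      rw [hR, Matrix.diagonal_mul_diagonal]
      congr 1
      ext i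
      rw [Real.mul_self_sqrt (hl i)]
    have hRt : R.conjTranspose = R := by
      rw [hR, Matrix.diagonal_conjTranspose]
      simp
    have hP : (R * C * R).PosSemidef := by
      have := hC.mul_mul_conjTranspose_same R
      rwa [hRt] at this
    have hsc : scaleCross (R * C * R) s θ = R * scaleCross C s θ * R := by
      ext i j
      simp only [hR, scaleCross, Matrix.of_apply, Matrix.mul_diagonal, Matrix.diagonal_mul]
      split_ifs <;> ring
    have := det_one_add_le_scaleCross hP s h0 h1
    rw [hsc] at this
    rw [hRR, mul_assoc, mul_assoc, Matrix.det_one_add_mul_comm, Matrix.det_one_add_mul_comm R]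
    exact this
  have hpow : ∀ (t : ℝ) (I : Finset κ), ∏ i ∈ I, (if i ∈ J then t else 0)
      = if I ⊆ J then t ^ I.card else 0 := by
    intro t I
    split_ifs with h
    · rw [Finset.prod_congr rfl fun i hi => if_pos (h hi), Finset.prod_const]
    · obtain ⟨i, hi, hiJ⟩ := Finset.not_subset.1 h
      exact Finset.prod_eq_zero hi (if_neg hiJ)
  have hpos : ∀ ε : ℝ, 0 < ε → 0 ≤ ∑ I ∈ J.powerset, ε ^ (J.card - I.card) *
      (princCoeff (scaleCross C s θ) I - princCoeff C I) := by
    intro ε hε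
    have h := hdet (fun i => if i ∈ J then ε⁻¹ else 0)
      (fun i => by split_ifs <;> positivity)
    rw [det_one_add_diagonal_mul, det_one_add_diagonal_mul, ← sub_nonneg,
      ← Finset.sum_sub_distrib] at h
    have h2 : ∑ I ∈ J.powerset, ε ^ (J.card - I.card) *
      (princCoeff (scaleCross C s θ) I - princCoeff C I) = ε ^ J.card * ∑ I : Finset κ,
        ((∏ i ∈ I, if i ∈ J then ε⁻¹ else 0) * princCoeff (scaleCross C s θ) I -
        (∏ i ∈ I, if i ∈ J then ε⁻¹ else 0) * princCoeff C I) := by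
      rw [Finset.mul_sum]
      refine Finset.sum_subset_zero_on_sdiff (Finset.subset_univ _) ?_ ?_
      · intro I hI
        rw [hpow, if_neg (by simpa using hI)]
        ring
      · intro I hI
        have hIJ := Finset.mem_powerset.1 hI
        rw [hpow, if_pos hIJ, ← mul_sub, ← mul_assoc, inv_pow,
          pow_sub₀ _ hε.ne' (Finset.card_le_card hIJ)]
    rw [h2]
    positivity
  have hlim : Filter.Tendsto (fun ε : ℝ => ∑ I ∈ J.powerset, ε ^ (J.card - I.card) *
      (princCoeff (scaleCross C s θ) I - princCoeff C I)) (nhdsWithin 0 (Set.Ioi 0))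
      (nhds (princCoeff (scaleCross C s θ) J - princCoeff C J)) := by
    have hc : Continuous (fun ε : ℝ => ∑ I ∈ J.powerset, ε ^ (J.card - I.card) *
      (princCoeff (scaleCross C s θ) I - princCoeff C I)) := by fun_prop
    have := (hc.tendsto 0).mono_left (nhdsWithin_le_nhds (s := Set.Ioi 0))
    convert this using 2
    rw [Finset.sum_eq_single_of_mem J (Finset.mem_powerset_self J)]
    · simp
    · intro I hI hne
      have : I.card < J.card := Finset.card_lt_card
        ((Finset.mem_powerset.1 hI).ssubset_of_ne hne)
      rw [zero_pow (by omega), zero_mul]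
  have := ge_of_tendsto hlim (Filter.eventually_of_mem self_mem_nhdsWithin fun ε hε => hpos ε hε)
  linarith

lemma differentiable_princCoeff_scaleCross {κ : Type*} [Fintype κ] [DecidableEq κ]
    (C : Matrix κ κ ℝ) (s : κ → Bool) (J : Finset κ) :
    Differentiable ℝ fun θ => princCoeff (scaleCross C s θ) J := by
  have h : ∀ θ, princCoeff (scaleCross C s θ) J = (Matrix.of fun i j =>
      if i ∈ J then (if s i = s j then C i j else θ * C i j) else
        (1 : Matrix κ κ ℝ) i j).det := by
    intro θ
    rw [princCoeff, Matrix.detRowAlternating, Matrix.det]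
    congr 1
    ext i j
    by_cases hi : i ∈ J <;> simp [hi, Finset.piecewise, scaleCross]
  simp_rw [h, Matrix.det_apply]
  refine Differentiable.fun_sum fun σ _ => Differentiable.const_smul ?_ _
  refine Differentiable.fun_finsetProd fun i _ => ?_
  simp only [Matrix.of_apply]
  split_ifs <;> fun_prop

lemma diagonal_mul_gram_det_eq {κ n : Type*} [Fintype κ] [DecidableEq κ] [Fintype n]
    [DecidableEq n] (M : Matrix κ n ℝ) (l : κ → ℝ) :
    (1 + M.transpose * Matrix.diagonal l * M).det
      = (1 + Matrix.diagonal l * (M * M.transpose)).det := by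
  rw [Matrix.mul_assoc, Matrix.det_one_add_mul_comm, Matrix.mul_assoc]

lemma posSemidef_transpose_mul_diagonal_mul {κ n : Type*} [Fintype κ] [DecidableEq κ] [Fintype n]
    (M : Matrix κ n ℝ) {l : κ → ℝ} (hl : ∀ j, 0 ≤ l j) :
    (M.transpose * Matrix.diagonal l * M).PosSemidef := by
  have h : (Matrix.diagonal l).PosSemidef := Matrix.PosSemidef.diagonal hl
  simpa using h.conjTranspose_mul_mul_same M

lemma det_one_add_diagonal_mul_gram_pos {κ n : Type*} [Fintype κ] [DecidableEq κ] [Fintype n]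
    (M : Matrix κ n ℝ) {l : κ → ℝ} (hl : ∀ j, 0 ≤ l j) :
    0 < (1 + Matrix.diagonal l * (M * M.transpose)).det := by
  classical
  rw [← diagonal_mul_gram_det_eq]
  exact (posSemidef_transpose_mul_diagonal_mul M hl).det_one_add_pos

lemma integral_exp_neg_sum_mul_sq {κ n : Type*} [Fintype κ] [DecidableEq κ] [Fintype n]
    (M : Matrix κ n ℝ) {l : κ → ℝ} (hl : ∀ j, 0 ≤ l j) :
    ∫ x, Real.exp (-∑ j, l j * ((M.mulVec x j) ^ 2 / 2)) ∂(stdPi n)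
      = (√(1 + Matrix.diagonal l * (M * M.transpose)).det)⁻¹ := by
  classical
  rw [← diagonal_mul_gram_det_eq,
    ← integral_exp_neg_quadratic_stdPi (posSemidef_transpose_mul_diagonal_mul M hl)]
  refine integral_congr_ae (Filter.Eventually.of_forall fun x => ?_)
  dsimp only
  congr 1
  rw [neg_div, ← Matrix.mulVec_mulVec, ← Matrix.mulVec_mulVec, Matrix.dotProduct_mulVec,
    Matrix.vecMul_transpose, dotProduct, Finset.sum_div]
  congr 1
  refine Finset.sum_congr rfl fun j _ => ?_
  rw [Matrix.mulVec_diagonal]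
  ring

/-- Rows of a Gaussian vector whose coordinates with distinct labels have their correlation
scaled by `τ`. -/
noncomputable def crossRows {κ ι : Type*} (u : Matrix κ ι ℝ) (s : κ → Bool) (τ : ℝ) :
    Matrix κ (ι ⊕ ι) ℝ :=
  Matrix.of fun i => Sum.elim (fun k => if s i then u i k else τ * u i k)
    (fun k => if s i then 0 else √(1 - τ ^ 2) * u i k)

lemma crossRows_mul_transpose {κ ι : Type*} [Fintype ι] (u : Matrix κ ι ℝ) (s : κ → Bool)
    {τ : ℝ} (h0 : 0 ≤ τ) (h1 : τ ≤ 1) :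
    crossRows u s τ * (crossRows u s τ).transpose = scaleCross (u * u.transpose) s τ := by
  have hs : √(1 - τ ^ 2) * √(1 - τ ^ 2) = 1 - τ ^ 2 :=
    Real.mul_self_sqrt (by nlinarith)
  ext i j
  simp only [crossRows, scaleCross, Matrix.mul_apply, Matrix.transpose_apply, Matrix.of_apply,
    Fintype.sum_sum_type, Sum.elim_inl, Sum.elim_inr]
  rw [← Finset.sum_add_distrib]
  cases hi : s i <;> cases hj : s j <;> simp only [if_true, if_false, Finset.mul_sum,
    Bool.false_eq_true, reduceCtorEq] <;> refine Finset.sum_congr rfl fun k _ => ?_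
  · linear_combination (u i k * u j k) * hs
  all_goals ring

lemma integral_prod_eval_exp_neg {Ω κ : Type*} [MeasurableSpace Ω] [Fintype κ] [DecidableEq κ]
    (ν : Measure Ω) [IsFiniteMeasure ν] (W : Ω → κ → ℝ) (hW : Measurable W)
    (hW0 : ∀ ω j, 0 ≤ W ω j) (P : κ → Polynomial ℝ) (N : ℕ) (hN : ∀ j, (P j).natDegree < N) :
    ∫ ω, ∏ j, (P j).eval (Real.exp (-W ω j)) ∂ν
      = ∑ k ∈ Fintype.piFinset fun _ : κ => Finset.range N, (∏ j, (P j).coeff (k j)) *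
        ∫ ω, Real.exp (-∑ j, (k j : ℝ) * W ω j) ∂ν := by
  have h : ∀ ω, ∏ j, (P j).eval (Real.exp (-W ω j))
      = ∑ k ∈ Fintype.piFinset fun _ : κ => Finset.range N, (∏ j, (P j).coeff (k j)) *
        Real.exp (-∑ j, (k j : ℝ) * W ω j) := by
    intro ω
    rw [Finset.prod_congr rfl fun j _ => Polynomial.eval_eq_sum_range' (hN j) _,
      Finset.prod_univ_sum]
    refine Finset.sum_congr rfl fun k _ => ?_
    rw [Finset.prod_mul_distrib, ← Finset.sum_neg_distrib, Real.exp_sum]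
    congr 1
    refine Finset.prod_congr rfl fun j _ => ?_
    rw [← Real.exp_nat_mul]
    ring_nf
  simp_rw [h]
  rw [integral_finsetSum]
  · simp_rw [integral_const_mul]
  · intro k _
    refine Integrable.const_mul ?_ _
    refine Integrable.of_bound (C := 1) (by
      apply Measurable.aestronglyMeasurable
      fun_prop) (Filter.Eventually.of_forall fun ω => ?_)
    rw [Real.norm_eq_abs, Real.abs_exp, Real.exp_le_one_iff, neg_nonpos]
    exact Finset.sum_nonneg fun j _ => mul_nonneg (Nat.cast_nonneg _) (hW0 ω j)

lemma integral_exp_neg_sum_mul_sq_three {κ n : Type*} [Fintype κ] [DecidableEq κ] [Fintype n]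
    (M : Matrix κ n ℝ) {l : κ → ℝ} (hl : ∀ j, 0 ≤ l j) :
    ∫ x : Fin 3 → n → ℝ, Real.exp (-∑ j, l j * ∑ a, ((M.mulVec (x a) j) ^ 2 / 2))
      ∂(Measure.pi fun _ => stdPi n)
      = (√(1 + Matrix.diagonal l * (M * M.transpose)).det)⁻¹ ^ 3 := by
  have h := integral_fintype_prod_eq_pow (𝕜 := ℝ) (ι := Fin 3)
    (fun y : n → ℝ => Real.exp (-∑ j, l j * ((M.mulVec y j) ^ 2 / 2))) (μ := stdPi n)
  rw [integral_exp_neg_sum_mul_sq M hl] at h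
  simp only [Fintype.card_fin] at h
  rw [← h]
  refine integral_congr_ae (Filter.Eventually.of_forall fun x => ?_)
  dsimp only
  rw [← Real.exp_sum, Finset.sum_neg_distrib, Finset.sum_comm]
  simp_rw [Finset.mul_sum]

lemma integral_prod_eval_crossRows_le {κ ι : Type*} [Fintype κ] [DecidableEq κ] [Fintype ι]
    (u : Matrix κ ι ℝ) (s : κ → Bool) (P : κ → Polynomial ℝ)
    (hP : ∀ j, ∀ t ∈ Set.Icc (0 : ℝ) 1, 0 ≤ (P j).eval t)
    (hP' : ∀ j, ∀ t ∈ Set.Icc (0 : ℝ) 1, 0 ≤ (P j).derivative.eval t) :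
    ∫ x, ∏ j, (P j).eval (Real.exp (-((crossRows u s 0).mulVec x j ^ 2 / 2))) ∂(stdPi (ι ⊕ ι)) ≤
    ∫ x, ∏ j, (P j).eval (Real.exp (-((crossRows u s 1).mulVec x j ^ 2 / 2)))
      ∂(stdPi (ι ⊕ ι)) := by
  set C := u * u.transpose with hC
  obtain ⟨N, hN⟩ : ∃ N, ∀ j, (P j).natDegree < N :=
    ⟨(Finset.univ.sup fun j => (P j).natDegree) + 1, fun j =>
      Nat.lt_succ_of_le (Finset.le_sup (f := fun j => (P j).natDegree) (Finset.mem_univ j))⟩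
  set K := Fintype.piFinset fun _ : κ => Finset.range N with hK
  set D : (κ → ℕ) → ℝ → ℝ := fun k τ =>
    ∑ J : Finset κ, (∏ i ∈ J, (k i : ℝ)) * princCoeff (scaleCross C s τ) J with hD
  have hDdet : ∀ k τ, D k τ
      = (1 + Matrix.diagonal (fun i => (k i : ℝ)) * scaleCross C s τ).det := fun k τ =>
    (det_one_add_diagonal_mul _ _).symm
  have hDpos : ∀ k, ∀ τ ∈ Set.Icc (0 : ℝ) 1, 0 < D k τ := by
    intro k τ hτ
    rw [hDdet, ← crossRows_mul_transpose u s hτ.1 hτ.2]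
    exact det_one_add_diagonal_mul_gram_pos _ fun j => Nat.cast_nonneg _
  have hDdiff : ∀ k, Differentiable ℝ (D k) := fun k =>
    Differentiable.fun_sum fun J _ => (differentiable_princCoeff_scaleCross C s J).const_mul _
  have hDderiv : ∀ k τ, deriv (D k) τ = ∑ J : Finset κ, (∏ i ∈ J, (k i : ℝ)) *
      deriv (fun τ => princCoeff (scaleCross C s τ) J) τ := by
    intro k τ
    rw [hD, deriv_fun_sum fun J _ =>
      ((differentiable_princCoeff_scaleCross C s J).const_mul _).differentiableAt]
    refine Finset.sum_congr rfl fun J _ => ?_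
    rw [deriv_const_mul _ (differentiable_princCoeff_scaleCross C s J).differentiableAt]
  set Φ : ℝ → ℝ := fun τ => ∑ k ∈ K, (∏ j, (P j).coeff (k j)) * (√(D k τ))⁻¹ with hΦ
  have hΦint : ∀ τ ∈ Set.Icc (0 : ℝ) 1, ∫ x, ∏ j, (P j).eval (Real.exp
      (-((crossRows u s τ).mulVec x j ^ 2 / 2))) ∂(stdPi (ι ⊕ ι)) = Φ τ := by
    intro τ hτ
    rw [integral_prod_eval_exp_neg (stdPi (ι ⊕ ι))
      (fun x j => (crossRows u s τ).mulVec x j ^ 2 / 2) (by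
        apply Continuous.measurable
        fun_prop) (fun x j => by positivity) P N hN]
    refine Finset.sum_congr rfl fun k _ => ?_
    rw [integral_exp_neg_sum_mul_sq _ fun j => Nat.cast_nonneg _, hDdet,
      crossRows_mul_transpose u s hτ.1 hτ.2]
  have hcoeff : ∀ J, AntitoneOn (fun τ => princCoeff (scaleCross C s τ) J) (Set.Icc 0 1) := by
    intro J σ hσ τ hτ hle
    have hpsd : (scaleCross C s τ).PosSemidef := by
      rw [← crossRows_mul_transpose u s hτ.1 hτ.2]
      exact Matrix.posSemidef_self_mul_conjTranspose _
    rcases hτ.1.eq_or_lt with h | h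
    · have : σ = τ := le_antisymm hle (h ▸ hσ.1)
      rw [this]
    · have := princCoeff_le_scaleCross hpsd s (div_nonneg hσ.1 hτ.1) ((div_le_one h).2 hle) J
      rwa [scaleCross_scaleCross, div_mul_cancel₀ _ h.ne'] at this
  have hcoeff' : ∀ J, ∀ τ ∈ Set.Ioo (0 : ℝ) 1,
      deriv (fun τ => princCoeff (scaleCross C s τ) J) τ ≤ 0 := by
    intro J τ hτ
    have h1 : Set.Icc (0 : ℝ) 1 ∈ nhds τ := Icc_mem_nhds hτ.1 hτ.2
    rw [← derivWithin_of_mem_nhds h1]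
    exact (hcoeff J).derivWithin_nonpos
  have hmono : MonotoneOn Φ (Set.Icc 0 1) := by
    refine monotoneOn_of_deriv_nonneg (convex_Icc 0 1) ?_ ?_ ?_
    · refine continuousOn_finsetSum _ fun k _ => ContinuousOn.const_mul ?_ _ |>.congr fun _ _ => rfl
      refine ContinuousOn.inv₀ ?_ fun τ hτ => (Real.sqrt_pos.2 (hDpos k τ hτ)).ne'
      exact (Real.continuous_sqrt.comp (hDdiff k).continuous).continuousOn
    all_goals rw [interior_Icc]
    · intro τ hτ
      refine DifferentiableAt.differentiableWithinAt ?_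
      refine DifferentiableAt.fun_sum fun k _ => DifferentiableAt.const_mul ?_ _
      have hp := hDpos k τ (Set.Ioo_subset_Icc_self hτ)
      exact ((hDdiff k τ).sqrt hp.ne').inv (Real.sqrt_pos.2 hp).ne'
    · intro τ hτ
      have hτ' := Set.Ioo_subset_Icc_self hτ
      have hd : HasDerivAt Φ (∑ k ∈ K, (∏ j, (P j).coeff (k j)) *
          (-(1 / 2) * deriv (D k) τ * (√(D k τ))⁻¹ ^ 3)) τ := by
        refine HasDerivAt.fun_sum fun k _ => HasDerivAt.const_mul _ ?_
        have hp := hDpos k τ hτ'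
        have hsp := Real.sqrt_pos.2 hp
        have := ((hDdiff k τ).hasDerivAt.sqrt hp.ne').fun_inv hsp.ne'
        convert this using 1
        field_simp
      rw [hd.deriv]
      set Q : Finset κ → κ → Polynomial ℝ := fun J j =>
        if j ∈ J then Polynomial.X * (P j).derivative else P j with hQ
      have hQdeg : ∀ J j, (Q J j).natDegree < N := by
        intro J j
        simp only [hQ]
        split_ifs
        · by_cases h0 : (P j).natDegree = 0
          · rw [Polynomial.eq_C_of_natDegree_eq_zero h0]
            simpa using (Nat.zero_le _).trans_lt (hN j)
          · have h1 := Polynomial.natDegree_derivative_lt h0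
            have h2 := Polynomial.natDegree_mul_le (p := Polynomial.X) (q := (P j).derivative)
            have h3 := Polynomial.natDegree_X_le (R := ℝ)
            have := hN j
            omega
        · exact hN j
      have hQcoeff : ∀ J j m, (Q J j).coeff m = (if j ∈ J then (m : ℝ) else 1) * (P j).coeff m := by
        intro J j m
        simp only [hQ]
        split_ifs
        · cases m with
          | zero => simp
          | succ m => rw [Polynomial.coeff_X_mul, Polynomial.coeff_derivative]; push_cast; ring
        · simp
      have hQint : ∀ J, ∫ x : Fin 3 → ι ⊕ ι → ℝ, ∏ j, (Q J j).eval (Real.exp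
          (-∑ a, ((crossRows u s τ).mulVec (x a) j ^ 2 / 2)))
            ∂(Measure.pi fun _ => stdPi (ι ⊕ ι)) = ∑ k ∈ K, (∏ j, (P j).coeff (k j)) *
            (∏ j ∈ J, (k j : ℝ)) * (√(D k τ))⁻¹ ^ 3 := by
        intro J
        rw [integral_prod_eval_exp_neg (Measure.pi fun _ => stdPi (ι ⊕ ι))
          (fun x j => ∑ a, (crossRows u s τ).mulVec (x a) j ^ 2 / 2) (by
            apply Continuous.measurable
            fun_prop) (fun x j => by positivity) (Q J) N (hQdeg J)]
        refine Finset.sum_congr rfl fun k _ => ?_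
        rw [integral_exp_neg_sum_mul_sq_three _ fun j => Nat.cast_nonneg _, hDdet,
          crossRows_mul_transpose u s hτ'.1 hτ'.2]
        congr 1
        simp_rw [hQcoeff]
        rw [Finset.prod_mul_distrib, mul_comm]
        congr 1
        simp
      have hQnn : ∀ J, 0 ≤ ∑ k ∈ K, (∏ j, (P j).coeff (k j)) *
            (∏ j ∈ J, (k j : ℝ)) * (√(D k τ))⁻¹ ^ 3 := by
        intro J
        rw [← hQint J]
        refine integral_nonneg fun x => Finset.prod_nonneg fun j _ => ?_
        have hmem : Real.exp (-∑ a, ((crossRows u s τ).mulVec (x a) j ^ 2 / 2))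
            ∈ Set.Icc (0 : ℝ) 1 := by
          refine ⟨(Real.exp_pos _).le, Real.exp_le_one_iff.2 (neg_nonpos.2 ?_)⟩
          positivity
        simp only [hQ]
        split_ifs
        · rw [Polynomial.eval_mul, Polynomial.eval_X]
          exact mul_nonneg hmem.1 (hP' j _ hmem)
        · exact hP j _ hmem
      have hsum : ∑ k ∈ K, (∏ j, (P j).coeff (k j)) *
          (-(1 / 2) * deriv (D k) τ * (√(D k τ))⁻¹ ^ 3) = ∑ J : Finset κ,
          (-(1 / 2) * deriv (fun τ => princCoeff (scaleCross C s τ) J) τ) *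
          ∑ k ∈ K, (∏ j, (P j).coeff (k j)) * (∏ j ∈ J, (k j : ℝ)) * (√(D k τ))⁻¹ ^ 3 := by
        simp_rw [hDderiv, Finset.mul_sum, Finset.sum_mul, Finset.mul_sum]
        rw [Finset.sum_comm]
        refine Finset.sum_congr rfl fun J _ => Finset.sum_congr rfl fun k _ => ?_
        ring
      rw [hsum]
      refine Finset.sum_nonneg fun J _ => mul_nonneg ?_ (hQnn J)
      have := hcoeff' J τ hτ
      linarith
  have h0 : (0 : ℝ) ∈ Set.Icc (0 : ℝ) 1 := by simp
  have h1 : (1 : ℝ) ∈ Set.Icc (0 : ℝ) 1 := by simp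
  rw [hΦint 0 h0, hΦint 1 h1]
  exact hmono h0 h1 zero_le_one

/-- Increasing polynomials on `[0, 1]` converging to the indicator of `[exp (-1/2), 1]`. -/
noncomputable def stepPoly (k : ℕ) : Polynomial ℝ :=
  1 - (1 - Polynomial.X ^ k) ^ ⌈k * Real.exp (k / 2)⌉₊

lemma stepPoly_eval (k : ℕ) (t : ℝ) :
    (stepPoly k).eval t = 1 - (1 - t ^ k) ^ ⌈k * Real.exp (k / 2)⌉₊ := by
  simp [stepPoly]

lemma stepPoly_eval_mem (k : ℕ) {t : ℝ} (ht : t ∈ Set.Icc (0 : ℝ) 1) :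
    (stepPoly k).eval t ∈ Set.Icc (0 : ℝ) 1 := by
  have h1 : t ^ k ≤ 1 := pow_le_one₀ ht.1 ht.2
  have h0 : 0 ≤ t ^ k := pow_nonneg ht.1 _
  have h2 := pow_le_one₀ (n := ⌈k * Real.exp (k / 2)⌉₊) (sub_nonneg.2 h1) (by linarith)
  have h3 := pow_nonneg (sub_nonneg.2 h1) ⌈k * Real.exp (k / 2)⌉₊
  rw [stepPoly_eval]
  constructor <;> linarith

lemma stepPoly_derivative_eval_nonneg (k : ℕ) {t : ℝ} (ht : t ∈ Set.Icc (0 : ℝ) 1) :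
    0 ≤ (stepPoly k).derivative.eval t := by
  have h1 : t ^ k ≤ 1 := pow_le_one₀ ht.1 ht.2
  have h0 := ht.1
  have h2 : 0 ≤ 1 - t ^ k := by linarith
  simp [stepPoly, Polynomial.derivative_pow]
  positivity

lemma tendsto_stepPoly_eval_exp_neg (z : ℝ) (hz : 0 ≤ z) :
    Filter.Tendsto (fun k => (stepPoly k).eval (Real.exp (-z))) Filter.atTop
      (nhds (if z ≤ 1 / 2 then 1 else 0)) := by
  have ha : ∀ k : ℕ, Real.exp (-z) ^ k = Real.exp (-(k * z)) := by
    intro k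
    rw [← Real.exp_nat_mul]
    ring_nf
  have ha1 : ∀ k : ℕ, Real.exp (-(k * z)) ≤ 1 := fun k =>
    Real.exp_le_one_iff.2 (neg_nonpos.2 (by positivity))
  simp_rw [stepPoly_eval, ha]
  split_ifs with h
  · suffices Filter.Tendsto (fun k : ℕ => (1 - Real.exp (-(k * z))) ^ ⌈k * Real.exp (k / 2)⌉₊)
        Filter.atTop (nhds 0) by simpa using this.const_sub 1
    refine squeeze_zero (g := fun k : ℕ => Real.exp (-(k : ℝ)))
      (fun k => pow_nonneg (sub_nonneg.2 (ha1 k)) _) (fun k => ?_)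
      (Real.tendsto_exp_neg_atTop_nhds_zero.comp tendsto_natCast_atTop_atTop)
    calc (1 - Real.exp (-(k * z))) ^ ⌈k * Real.exp (k / 2)⌉₊
        ≤ Real.exp (-Real.exp (-(k * z))) ^ ⌈k * Real.exp (k / 2)⌉₊ :=
          pow_le_pow_left₀ (sub_nonneg.2 (ha1 k)) (by
            have := Real.add_one_le_exp (-Real.exp (-(k * z)))
            linarith) _
      _ = Real.exp (-(⌈k * Real.exp (k / 2)⌉₊ * Real.exp (-(k * z)))) := by
          rw [← Real.exp_nat_mul]
          ring_nf
      _ ≤ Real.exp (-(k : ℝ)) := by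
          refine Real.exp_le_exp.2 (neg_le_neg ?_)
          calc (k : ℝ) ≤ k * (Real.exp (k / 2) * Real.exp (-(k * z))) := by
                refine le_mul_of_one_le_right (Nat.cast_nonneg _) ?_
                rw [← Real.exp_add]
                refine Real.one_le_exp ?_
                have : (k : ℝ) * z ≤ k * (1 / 2) := by gcongr
                linarith
            _ = k * Real.exp (k / 2) * Real.exp (-(k * z)) := by ring
            _ ≤ _ := by
                gcongr
                exact Nat.le_ceil _
  · push Not at h
    have hd : 0 < z - 1 / 2 := by linarith
    have hlim : Filter.Tendsto (fun k : ℕ => (k : ℝ) * Real.exp (-(z - 1 / 2)) ^ k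
        + Real.exp (-(z - 1 / 2)) ^ k) Filter.atTop (nhds 0) := by
      have hlt : Real.exp (-(z - 1 / 2)) < 1 := Real.exp_lt_one_iff.2 (by linarith)
      have := (tendsto_self_mul_const_pow_of_lt_one (Real.exp_pos _).le hlt).add
        (tendsto_pow_atTop_nhds_zero_of_lt_one (Real.exp_pos _).le hlt)
      simpa using this
    refine squeeze_zero (fun k => ?_) (fun k => ?_) hlim
    · rw [sub_nonneg]
      exact pow_le_one₀ (sub_nonneg.2 (ha1 k)) (by have := Real.exp_pos (-(k * z)); linarith)
    · have hb := one_add_mul_le_pow (a := -Real.exp (-(k * z))) (by have := ha1 k; linarith)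
        ⌈k * Real.exp (k / 2)⌉₊
      have hc := (Nat.ceil_lt_add_one (a := k * Real.exp (k / 2)) (by positivity)).le
      have hp := Real.exp_pos (-(k * z))
      have he : Real.exp (k / 2) * Real.exp (-(k * z)) = Real.exp (-(z - 1 / 2)) ^ k := by
        rw [← Real.exp_add, ← Real.exp_nat_mul]
        ring_nf
      have he2 : Real.exp (-(k * z)) ≤ Real.exp (-(z - 1 / 2)) ^ k := by
        rw [← he]
        exact le_mul_of_one_le_left hp.le (Real.one_le_exp (by positivity))
      calc 1 - (1 - Real.exp (-(k * z))) ^ ⌈k * Real.exp (k / 2)⌉₊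
          ≤ ⌈k * Real.exp (k / 2)⌉₊ * Real.exp (-(k * z)) := by
            rw [← sub_eq_add_neg] at hb
            linarith
        _ ≤ (k * Real.exp (k / 2) + 1) * Real.exp (-(k * z)) := by gcongr
        _ = k * (Real.exp (k / 2) * Real.exp (-(k * z))) + Real.exp (-(k * z)) := by ring
        _ ≤ _ := by rw [he]; gcongr

lemma tendsto_integral_prod_stepPoly {κ n : Type*} [Fintype κ] [Fintype n] (M : Matrix κ n ℝ) :
    Filter.Tendsto (fun k => ∫ x, ∏ j, (stepPoly k).eval (Real.exp (-(M.mulVec x j ^ 2 / 2)))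
      ∂(stdPi n)) Filter.atTop (nhds ((stdPi n).real {x | ∀ j, |M.mulVec x j| ≤ 1})) := by
  have hms : MeasurableSet {x : n → ℝ | ∀ j, |M.mulVec x j| ≤ 1} := by
    rw [Set.ofPred_forall]
    exact (isClosed_iInter fun j => isClosed_le (by fun_prop) (by fun_prop)).measurableSet
  have hmem : ∀ (x : n → ℝ) j, Real.exp (-(M.mulVec x j ^ 2 / 2)) ∈ Set.Icc (0 : ℝ) 1 :=
    fun x j => ⟨(Real.exp_pos _).le, Real.exp_le_one_iff.2 (neg_nonpos.2 (by positivity))⟩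
  rw [← integral_indicator_one hms]
  refine tendsto_integral_of_dominated_convergence (fun _ => 1) (fun k => ?_)
    (integrable_const _) (fun k => ?_) ?_
  · apply Continuous.aestronglyMeasurable
    refine continuous_finsetProd _ fun j _ => (stepPoly k).continuous.comp ?_
    fun_prop
  · refine Filter.Eventually.of_forall fun x => ?_
    have h := fun j => stepPoly_eval_mem k (hmem x j)
    rw [Real.norm_eq_abs, abs_of_nonneg (Finset.prod_nonneg fun j _ => (h j).1)]
    exact Finset.prod_le_one (fun j _ => (h j).1) fun j _ => (h j).2
  · refine Filter.Eventually.of_forall fun x => ?_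
    have h := tendsto_finsetProd Finset.univ fun j _ =>
      tendsto_stepPoly_eval_exp_neg (M.mulVec x j ^ 2 / 2) (by positivity)
    convert h using 2
    have hiff : ∀ j, M.mulVec x j ^ 2 / 2 ≤ 1 / 2 ↔ |M.mulVec x j| ≤ 1 := by
      intro j
      rw [← sq_le_one_iff_abs_le_one]
      constructor <;> intro h <;> linarith
    simp only [hiff, Finset.prod_ite_zero, Set.indicator, Set.mem_ofPred_eq, Finset.mem_univ,
      true_implies, Finset.prod_const_one, Pi.one_apply]

/-- Royen's theorem: the Gaussian correlation inequality for symmetric slabs. -/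
lemma stdPi_slabs_mul_le {κ ι : Type*} [Fintype κ] [Fintype ι]
    (u : Matrix κ ι ℝ) (s : κ → Bool) :
    (stdPi ι).real {x | ∀ j, s j = true → |u.mulVec x j| ≤ 1} *
      (stdPi ι).real {x | ∀ j, s j = false → |u.mulVec x j| ≤ 1} ≤
      (stdPi ι).real {x | ∀ j, |u.mulVec x j| ≤ 1} := by
  classical
  have key : (stdPi (ι ⊕ ι)).real {x | ∀ j, |(crossRows u s 0).mulVec x j| ≤ 1} ≤
      (stdPi (ι ⊕ ι)).real {x | ∀ j, |(crossRows u s 1).mulVec x j| ≤ 1} :=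
    le_of_tendsto_of_tendsto' (tendsto_integral_prod_stepPoly _) (tendsto_integral_prod_stepPoly _)
      fun k => integral_prod_eval_crossRows_le u s (fun _ => stepPoly k)
        (fun _ t ht => (stepPoly_eval_mem k ht).1)
        (fun _ t ht => stepPoly_derivative_eval_nonneg k ht)
  have hmp := measurePreserving_sumPiEquivProdPi (X := fun _ : ι ⊕ ι => ℝ)
    (fun _ => gaussianReal 0 1)
  have hms : ∀ b : Bool, MeasurableSet {x : ι → ℝ | ∀ j, s j = b → |u.mulVec x j| ≤ 1} := by
    intro b
    simp only [Set.ofPred_forall]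
    exact (isClosed_iInter fun j => isClosed_iInter fun _ =>
      isClosed_le (by fun_prop) (by fun_prop)).measurableSet
  have hms' : MeasurableSet {x : ι → ℝ | ∀ j, |u.mulVec x j| ≤ 1} := by
    simp only [Set.ofPred_forall]
    exact (isClosed_iInter fun j => isClosed_le (by fun_prop) (by fun_prop)).measurableSet
  have e0 : {x | ∀ j, |(crossRows u s 0).mulVec x j| ≤ 1} =
      MeasurableEquiv.sumPiEquivProdPi (fun _ : ι ⊕ ι => ℝ) ⁻¹'
      ({x | ∀ j, s j = true → |u.mulVec x j| ≤ 1} ×ˢ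
        {x | ∀ j, s j = false → |u.mulVec x j| ≤ 1}) := by
    ext x
    simp only [Set.mem_ofPred_eq, Set.mem_preimage, Set.mem_prod, ← forall_and]
    refine forall_congr' fun j => ?_
    cases hj : s j <;> simp [crossRows, Matrix.mulVec, dotProduct, hj] <;> rfl
  have e1 : {x | ∀ j, |(crossRows u s 1).mulVec x j| ≤ 1} =
      MeasurableEquiv.sumPiEquivProdPi (fun _ : ι ⊕ ι => ℝ) ⁻¹'
      ({x | ∀ j, |u.mulVec x j| ≤ 1} ×ˢ Set.univ) := by
    ext x
    simp only [Set.mem_ofPred_eq, Set.mem_preimage, Set.mem_prod, Set.mem_univ, and_true]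
    refine forall_congr' fun j => ?_
    simp [crossRows, Matrix.mulVec, dotProduct]
    rfl
  rw [e0, e1, hmp.measureReal_preimage ((hms _).prod (hms _)).nullMeasurableSet,
    hmp.measureReal_preimage (hms'.prod MeasurableSet.univ).nullMeasurableSet,
    measureReal_prod_prod, measureReal_prod_prod, probReal_univ, mul_one] at key
  exact key

/-! ### Convex sets in finite dimension -/

lemma exists_nat_slabs {ι : Type*} [Fintype ι] {A : Set (ι → ℝ)} (hc : IsClosed A)
    (hA : Convex ℝ A) (hs : ∀ x ∈ A, -x ∈ A) (hne : A.Nonempty) :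
    ∃ v : ℕ → ι → ℝ, A = {x | ∀ n, |v n ⬝ᵥ x| ≤ 1} := by
  classical
  have h0 : (0 : ι → ℝ) ∈ A := by
    obtain ⟨x, hx⟩ := hne
    simpa using hA.midpoint_mem hx (hs x hx)
  let I : Set (ι → ℝ) := {v | ∀ x ∈ A, |v ⬝ᵥ x| ≤ 1}
  have hsep : ∀ x ∉ A, ∃ v ∈ I, 1 < |v ⬝ᵥ x| := by
    intro x hx
    obtain ⟨f, c, hfA, hfx⟩ := geometric_hahn_banach_closed_point hA hc hx
    have hc0 : 0 < c := by simpa using hfA 0 h0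
    have hf : ∀ y, (fun i => f (Pi.single i 1) / c) ⬝ᵥ y = f y / c := by
      intro y
      conv_rhs => rw [pi_eq_sum_univ' y, map_sum, Finset.sum_div]
      refine Finset.sum_congr rfl fun i _ => ?_
      simp only [map_smul, smul_eq_mul]
      ring
    refine ⟨fun i => f (Pi.single i 1) / c, fun y hy => ?_, ?_⟩
    · rw [hf, abs_div, abs_of_pos hc0, div_le_one hc0, abs_le]
      have h1 := hfA y hy
      have h2 := hfA _ (hs y hy)
      rw [map_neg] at h2
      constructor <;> linarith
    · rw [hf, abs_div, abs_of_pos hc0, one_lt_div hc0]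
      exact hfx.trans_le (le_abs_self _)
  obtain ⟨T, hTI, hTc, hT⟩ := TopologicalSpace.isOpen_biUnion_countable I
    (fun v => {x : ι → ℝ | 1 < |v ⬝ᵥ x|}) fun v _ =>
      isOpen_lt continuous_const (by fun_prop)
  obtain ⟨e, he⟩ := (hTc.insert 0).exists_eq_range (Set.insert_nonempty _ _)
  refine ⟨e, Set.Subset.antisymm (fun x hx n => ?_) fun x hx => ?_⟩
  · have : e n ∈ insert 0 T := he ▸ Set.mem_range_self n
    rcases this with h | h
    · simp [h]
    · exact hTI h x hx
  · by_contra hxA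
    obtain ⟨v, hv, hvx⟩ := hsep x hxA
    have : x ∈ ⋃ v ∈ T, {x : ι → ℝ | 1 < |v ⬝ᵥ x|} := by
      rw [hT]; exact Set.mem_biUnion hv hvx
    obtain ⟨w, hw, hwx⟩ := Set.mem_iUnion₂.1 this
    have : w ∈ Set.range e := he ▸ Set.mem_insert_of_mem _ hw
    obtain ⟨n, rfl⟩ := this
    exact absurd (hx n) (not_le.2 hwx)

lemma stdPi_mul_le_inter_of_isClosed {ι : Type*} [Fintype ι] {A B : Set (ι → ℝ)}
    (hAc : IsClosed A) (hA : Convex ℝ A) (hAs : ∀ x ∈ A, -x ∈ A)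
    (hBc : IsClosed B) (hB : Convex ℝ B) (hBs : ∀ x ∈ B, -x ∈ B) :
    (stdPi ι).real A * (stdPi ι).real B ≤ (stdPi ι).real (A ∩ B) := by
  rcases A.eq_empty_or_nonempty with rfl | hAne
  · simp
  rcases B.eq_empty_or_nonempty with rfl | hBne
  · simp
  obtain ⟨v, rfl⟩ := exists_nat_slabs hAc hA hAs hAne
  obtain ⟨w, rfl⟩ := exists_nat_slabs hBc hB hBs hBne
  have hlim : ∀ S : ℕ → Set (ι → ℝ), (∀ n, IsClosed (S n)) → Filter.Tendsto
      (fun N : ℕ => (stdPi ι).real {x | ∀ n < N, x ∈ S n}) Filter.atTop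
      (nhds ((stdPi ι).real {x | ∀ n, x ∈ S n})) := by
    intro S hS
    have e : {x | ∀ n, x ∈ S n} = ⋂ N : ℕ, {x | ∀ n < N, x ∈ S n} := by
      ext x
      simp only [Set.mem_ofPred_eq, Set.mem_iInter]
      exact ⟨fun h _ n _ => h n, fun h n => h (n + 1) n n.lt_succ_self⟩
    rw [e]
    refine (ENNReal.tendsto_toReal (measure_ne_top _ _)).comp
      (tendsto_measure_iInter_atTop (fun N => ?_) (fun M N hMN x hx n hn => hx n (hn.trans_le hMN))
        ⟨0, measure_ne_top _ _⟩)
    simp only [Set.ofPred_forall]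
    exact (isClosed_iInter fun n => isClosed_iInter fun _ => hS n).measurableSet.nullMeasurableSet
  have hcl : ∀ v : ι → ℝ, IsClosed {x | |v ⬝ᵥ x| ≤ 1} := fun v =>
    isClosed_le (by fun_prop) continuous_const
  have e : {x | ∀ n, |v n ⬝ᵥ x| ≤ 1} ∩ {x | ∀ n, |w n ⬝ᵥ x| ≤ 1} =
      {x | ∀ n, x ∈ {x | |v n ⬝ᵥ x| ≤ 1} ∩ {x | |w n ⬝ᵥ x| ≤ 1}} := by
    ext x; exact forall_and.symm
  rw [e]
  refine le_of_tendsto_of_tendsto' ((hlim _ fun n => hcl (v n)).mul (hlim _ fun n => hcl (w n)))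
    (hlim _ fun n => (hcl (v n)).inter (hcl (w n))) fun N => ?_
  have key := stdPi_slabs_mul_le (ι := ι)
    (Matrix.of (Sum.elim (fun k : Fin N => v k) fun k : Fin N => w k)) Sum.isLeft
  convert key using 3 <;> ext x <;>
    simp only [Set.mem_ofPred_eq, Matrix.mulVec, Matrix.of_apply, Sum.forall, Sum.elim_inl,
      Sum.elim_inr, Sum.isLeft_inl, Sum.isLeft_inr, Fin.forall_iff, forall_and, Set.mem_inter_iff,
      forall_true_left, reduceCtorEq, IsEmpty.forall_iff, implies_true, true_and, and_true] <;>
    rfl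

lemma stdPi_fin_absolutelyContinuous (n : ℕ) : stdPi (Fin n) ≪ volume := by
  induction n with
  | zero =>
    have h : stdPi (Fin 0) = volume := by
      rw [stdPi, Measure.pi_of_empty, volume_pi, Measure.pi_of_empty]
    rw [h]
  | succ n ih =>
    have h1 := measurePreserving_piFinSuccAbove (fun _ : Fin (n + 1) => gaussianReal 0 1) 0
    have h2 := volume_preserving_piFinSuccAbove (fun _ : Fin (n + 1) => ℝ) 0
    have h3 : (gaussianReal 0 1).prod (stdPi (Fin n)) ≪
        (volume : Measure ℝ).prod (volume : Measure (Fin n → ℝ)) :=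
      (gaussianReal_absolutelyContinuous 0 one_ne_zero).prod ih
    refine Measure.AbsolutelyContinuous.mk fun s hs h => ?_
    rw [← h2.symm.map_eq, MeasurableEquiv.map_apply] at h
    rw [stdPi, ← h1.symm.map_eq, MeasurableEquiv.map_apply]
    exact h3 h

lemma stdPi_mul_le_inter {n : ℕ} {A B : Set (Fin n → ℝ)} (hA : Convex ℝ A)
    (hAs : ∀ x ∈ A, -x ∈ A) (hB : Convex ℝ B) (hBs : ∀ x ∈ B, -x ∈ B) :
    (stdPi (Fin n)).real A * (stdPi (Fin n)).real B ≤ (stdPi (Fin n)).real (A ∩ B) := by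
  have hcl : ∀ C : Set (Fin n → ℝ), Convex ℝ C → closure C =ᵐ[stdPi (Fin n)] C := by
    intro C hC
    refine (stdPi_fin_absolutelyContinuous n).ae_eq ?_
    refine Filter.EventuallyLE.antisymm ?_ subset_closure.eventuallyLE
    rw [ae_le_set]
    exact measure_mono_null (Set.sdiff_subset_sdiff_right interior_subset) (hC.addHaar_frontier volume)
  have hsym : ∀ C : Set (Fin n → ℝ), (∀ x ∈ C, -x ∈ C) → ∀ x ∈ closure C, -x ∈ closure C :=
    fun C hC x hx => map_mem_closure continuous_neg hx hC
  rw [← measureReal_congr (hcl A hA), ← measureReal_congr (hcl B hB),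
    ← measureReal_congr ((hcl A hA).inter (hcl B hB))]
  exact stdPi_mul_le_inter_of_isClosed isClosed_closure hA.closure (hsym A hAs) isClosed_closure
    hB.closure (hsym B hBs)

/-! ### From sets to functions -/

/-- The Gaussian correlation inequality for measurable symmetric convex sets. -/
def CorrelatesSymmConvex {V : Type*} [AddCommGroup V] [Module ℝ V] [MeasurableSpace V]
    (μ : Measure V) : Prop :=
  ∀ A B : Set V, MeasurableSet A → MeasurableSet B → Convex ℝ A → Convex ℝ B →
    (∀ x ∈ A, -x ∈ A) → (∀ x ∈ B, -x ∈ B) → μ A * μ B ≤ μ (A ∩ B)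

/-- A measurable function which is even and quasi-concave. -/
structure IsSymmQuasiconcave {V : Type*} [AddCommGroup V] [Module ℝ V] [MeasurableSpace V]
    (f : V → ℝ) : Prop where
  measurable : Measurable f
  symm : ∀ x, f (-x) = f x
  convex : ∀ c : ℝ, Convex ℝ {x | c ≤ f x}

/-- The region under the graphs of finitely many functions. -/
def subgraphPi {V ι : Type*} (f : ι → V → ℝ) : Set (V × (ι → ℝ)) :=
  {p | ∀ i, p.2 i ∈ Set.Ioc 0 (f i p.1)}

lemma measurableSet_subgraphPi {V ι : Type*} [MeasurableSpace V] [Fintype ι] {f : ι → V → ℝ}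
    (hf : ∀ i, Measurable (f i)) : MeasurableSet (subgraphPi f) := by
  have : subgraphPi f = ⋂ i, {p | 0 < p.2 i} ∩ {p | p.2 i ≤ f i p.1} := by
    ext p; simp [subgraphPi]
  rw [this]
  refine MeasurableSet.iInter fun i => ?_
  have h1 : Measurable fun p : V × (ι → ℝ) => p.2 i := by fun_prop
  have h2 : Measurable fun p : V × (ι → ℝ) => f i p.1 := (hf i).comp measurable_fst
  exact (measurableSet_lt measurable_const h1).inter (measurableSet_le h1 h2)

lemma volume_subgraphPi_section {V ι : Type*} [Fintype ι] (f : ι → V → ℝ) (x : V) :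
    volume (Prod.mk x ⁻¹' subgraphPi f) = ∏ i, ENNReal.ofReal (f i x) := by
  have : Prod.mk x ⁻¹' subgraphPi f = Set.univ.pi fun i => Set.Ioc 0 (f i x) := by
    ext t; simp [subgraphPi]
  rw [this, volume_pi_pi]
  simp

lemma convex_subgraphPi_section {V ι : Type*} [AddCommGroup V] [Module ℝ V] [MeasurableSpace V]
    {f : ι → V → ℝ} (hf : ∀ i, IsSymmQuasiconcave (f i)) (t : ι → ℝ) :
    Convex ℝ ((fun x => (x, t)) ⁻¹' subgraphPi f) := fun _ hx _ hy _ _ ha hb hab i =>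
  ⟨(hx i).1, (hf i).convex _ (hx i).2 (hy i).2 ha hb hab⟩

lemma neg_mem_subgraphPi_section {V ι : Type*} [AddCommGroup V] [Module ℝ V] [MeasurableSpace V]
    {f : ι → V → ℝ} (hf : ∀ i, IsSymmQuasiconcave (f i)) (t : ι → ℝ) :
    ∀ x ∈ (fun x => (x, t)) ⁻¹' subgraphPi f, -x ∈ (fun x => (x, t)) ⁻¹' subgraphPi f :=
  fun x hx i => ⟨(hx i).1, (hx i).2.trans_eq ((hf i).symm x).symm⟩

lemma lintegral_prod_eq_measure_subgraphPi {V ι : Type*} [MeasurableSpace V] [Fintype ι]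
    (μ : Measure V) [SFinite μ] {f : ι → V → ℝ} (hf : ∀ i, Measurable (f i)) :
    ∫⁻ x, ∏ i, ENNReal.ofReal (f i x) ∂μ = ∫⁻ t, μ ((fun x => (x, t)) ⁻¹' subgraphPi f) := by
  have h := measurableSet_subgraphPi hf
  simp_rw [← volume_subgraphPi_section]
  rw [← Measure.prod_apply h, Measure.prod_apply_symm h]

lemma CorrelatesSymmConvex.lintegral_prod_mul_le {V : Type*} [AddCommGroup V] [Module ℝ V]
    [MeasurableSpace V] {μ : Measure V} [SFinite μ] (hμ : CorrelatesSymmConvex μ)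
    {ι κ : Type*} [Fintype ι] [Fintype κ] {f : ι → V → ℝ} {g : κ → V → ℝ}
    (hf : ∀ i, IsSymmQuasiconcave (f i)) (hg : ∀ i, IsSymmQuasiconcave (g i)) :
    (∫⁻ x, ∏ i, ENNReal.ofReal (f i x) ∂μ) * (∫⁻ x, ∏ i, ENNReal.ofReal (g i x) ∂μ) ≤
      ∫⁻ x, (∏ i, ENNReal.ofReal (f i x)) * ∏ i, ENNReal.ofReal (g i x) ∂μ := by
  have hS := measurableSet_subgraphPi fun i => (hf i).measurable
  have hT := measurableSet_subgraphPi fun i => (hg i).measurable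
  let R : Set (V × ((ι → ℝ) × (κ → ℝ))) :=
    {p | (p.1, p.2.1) ∈ subgraphPi f ∧ (p.1, p.2.2) ∈ subgraphPi g}
  have hR : MeasurableSet R :=
    (hS.preimage (by fun_prop : Measurable fun p : V × ((ι → ℝ) × (κ → ℝ)) => (p.1, p.2.1))).inter
      (hT.preimage (by fun_prop : Measurable fun p : V × ((ι → ℝ) × (κ → ℝ)) => (p.1, p.2.2)))
  have e2 : ∫⁻ x, (∏ i, ENNReal.ofReal (f i x)) * ∏ i, ENNReal.ofReal (g i x) ∂μ =
      ∫⁻ p, μ ((fun x => (x, p)) ⁻¹' R) ∂(volume.prod volume) := by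
    simp_rw [← volume_subgraphPi_section]
    rw [← Measure.prod_apply_symm hR, Measure.prod_apply hR]
    refine lintegral_congr fun x => ?_
    rw [← Measure.prod_prod]
    rfl
  rw [lintegral_prod_eq_measure_subgraphPi μ fun i => (hf i).measurable,
    lintegral_prod_eq_measure_subgraphPi μ fun i => (hg i).measurable, e2, ← lintegral_prod_mul
    (measurable_measure_prodMk_right hS).aemeasurable
    (measurable_measure_prodMk_right hT).aemeasurable]
  refine lintegral_mono fun p => ?_
  exact hμ _ _ (measurable_prodMk_right hS) (measurable_prodMk_right hT) (convex_subgraphPi_section hf _)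
    (convex_subgraphPi_section hg _) (neg_mem_subgraphPi_section hf _)
    (neg_mem_subgraphPi_section hg _)

lemma correlatesSymmConvex_stdPi (n : ℕ) : CorrelatesSymmConvex (stdPi (Fin n)) := by
  intro A B _ _ hA hB hAs hBs
  have := stdPi_mul_le_inter hA hAs hB hBs
  rw [measureReal_def, measureReal_def, measureReal_def, ← ENNReal.toReal_mul] at this
  exact (ENNReal.toReal_le_toReal (by finiteness) (by finiteness)).1 this

/-! ### The Prékopa–Leindler inequality -/

open scoped Pointwise ENNReal in
lemma volume_add_le_of_isCompact {K L : Set ℝ} (hK : IsCompact K) (hL : IsCompact L)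
    (hK' : K.Nonempty) (hL' : L.Nonempty) : volume K + volume L ≤ volume (K + L) := by
  have h1 : (· + sInf L) '' K ∪ (sSup K + ·) '' L ⊆ K + L := by
    rintro _ (⟨x, hx, rfl⟩ | ⟨x, hx, rfl⟩)
    · exact Set.add_mem_add hx (hL.sInf_mem hL')
    · exact Set.add_mem_add (hK.sSup_mem hK') hx
  have h2 : (· + sInf L) '' K ∩ (sSup K + ·) '' L ⊆ {sSup K + sInf L} := by
    rintro _ ⟨⟨x, hx, rfl⟩, ⟨y, hy, hxy⟩⟩
    have h3 := le_csSup hK.bddAbove hx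
    have h4 := csInf_le hL.bddBelow hy
    simp only [Set.mem_singleton_iff] at hxy ⊢
    linarith
  have h3 : MeasurableSet ((sSup K + ·) '' L) :=
    (hL.image (by fun_prop)).measurableSet
  have h4 : AEDisjoint volume ((· + sInf L) '' K) ((sSup K + ·) '' L) :=
    measure_mono_null h2 (by simp)
  calc volume K + volume L = volume ((· + sInf L) '' K) + volume ((sSup K + ·) '' L) := by
        simp
    _ = volume ((· + sInf L) '' K ∪ (sSup K + ·) '' L) :=
        (measure_union₀ h3.nullMeasurableSet h4).symm
    _ ≤ _ := measure_mono h1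

open scoped Pointwise in
lemma volume_add_le {A B : Set ℝ} (hA : MeasurableSet A) (hB : MeasurableSet B)
    (hA' : A.Nonempty) (hB' : B.Nonempty) : volume A + volume B ≤ volume (A + B) := by
  obtain ⟨x, hx⟩ := hA'
  obtain ⟨y, hy⟩ := hB'
  rw [hA.measure_eq_iSup_isCompact, hB.measure_eq_iSup_isCompact]
  simp_rw [iSup_and']
  refine ENNReal.biSup_add_biSup_le' ⟨∅, by simp⟩ ⟨∅, by simp⟩ fun K hK L hL => ?_
  calc volume K + volume L ≤ volume (insert x K) + volume (insert y L) :=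
        add_le_add (measure_mono (Set.subset_insert _ _)) (measure_mono (Set.subset_insert _ _))
    _ ≤ volume (insert x K + insert y L) :=
        volume_add_le_of_isCompact (hK.2.insert x) (hL.2.insert y) (Set.insert_nonempty _ _)
          (Set.insert_nonempty _ _)
    _ ≤ _ := measure_mono (Set.add_subset_add (Set.insert_subset hx hK.1)
        (Set.insert_subset hy hL.1))

lemma lintegral_min_one_eq {V : Type*} [MeasurableSpace V] (μ : Measure V) [SFinite μ]
    {f : V → ENNReal} (hf : Measurable f) :
    ∫⁻ x, min (f x) 1 ∂μ = ∫⁻ t in Set.Ioo (0 : ℝ) 1, μ {x | ENNReal.ofReal t < f x} := by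
  have hS : MeasurableSet {p : V × ℝ | ENNReal.ofReal p.2 < f p.1} :=
    measurableSet_lt (by fun_prop) (hf.comp measurable_fst)
  have key : ∀ e : ENNReal,
      min e 1 = volume.restrict (Set.Ioo (0 : ℝ) 1) {t | ENNReal.ofReal t < e} := by
    intro e
    have h : ∀ r : ℝ, 0 ≤ r → r ≤ 1 →
        volume.restrict (Set.Ioo (0 : ℝ) 1) {t | t < r} = ENNReal.ofReal r := by
      intro r h0 h1
      rw [Measure.restrict_apply' measurableSet_Ioo]
      have : {t | t < r} ∩ Set.Ioo (0 : ℝ) 1 = Set.Ioo 0 r := by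
        ext t
        simp only [Set.mem_inter_iff, Set.mem_ofPred_eq, Set.mem_Ioo]
        exact ⟨fun ⟨h, h', _⟩ => ⟨h', h⟩, fun ⟨h, h'⟩ => ⟨h', h, h'.trans_le h1⟩⟩
      rw [this, Real.volume_Ioo, sub_zero]
    rcases le_total e 1 with he | he
    · have he' : e ≠ ⊤ := ne_top_of_le_ne_top ENNReal.one_ne_top he
      rw [min_eq_left he]
      have := h e.toReal ENNReal.toReal_nonneg (ENNReal.toReal_le_of_le_ofReal zero_le_one (by simpa))
      rw [ENNReal.ofReal_toReal he'] at this
      refine this.symm.trans ?_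
      rw [Measure.restrict_apply' measurableSet_Ioo, Measure.restrict_apply' measurableSet_Ioo]
      congr 1
      ext t
      simp only [Set.mem_inter_iff, Set.mem_ofPred_eq]
      refine and_congr_left fun ht => ?_
      exact (ENNReal.ofReal_lt_iff_lt_toReal ht.1.le he').symm
    · rw [min_eq_right he]
      have := h 1 zero_le_one le_rfl
      rw [ENNReal.ofReal_one] at this
      refine this.symm.trans ?_
      rw [Measure.restrict_apply' measurableSet_Ioo, Measure.restrict_apply' measurableSet_Ioo]
      congr 1
      ext t
      simp only [Set.mem_inter_iff, Set.mem_ofPred_eq]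
      refine and_congr_left fun ht => ⟨fun h => ?_, fun _ => ht.2⟩
      exact lt_of_lt_of_le (by simpa using h) he
  simp_rw [key]
  exact (Measure.prod_apply hS).symm.trans (Measure.prod_apply_symm hS)

lemma ENNReal.rpow_mul_rpow_le_add {a b : ℝ} (ha : 0 < a) (hb : 0 < b) (hab : a + b = 1)
    (x y : ENNReal) : x ^ a * y ^ b ≤ ENNReal.ofReal a * x + ENNReal.ofReal b * y := by
  have ha' : ENNReal.ofReal a ≠ 0 := by simpa
  have hb' : ENNReal.ofReal b ≠ 0 := by simpa
  by_cases hx : x = ⊤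
  · simp [hx, ENNReal.mul_top ha']
  by_cases hy : y = ⊤
  · simp [hy, ENNReal.mul_top hb']
  lift x to NNReal using hx
  lift y to NNReal using hy
  have := NNReal.geom_mean_le_arith_mean2_weighted a.toNNReal b.toNNReal x y
    (by rw [← Real.toNNReal_add ha.le hb.le, hab, Real.toNNReal_one])
  rw [Real.coe_toNNReal _ ha.le, Real.coe_toNNReal _ hb.le] at this
  rw [← ENNReal.coe_rpow_of_nonneg _ ha.le, ← ENNReal.coe_rpow_of_nonneg _ hb.le,
    ENNReal.ofReal, ENNReal.ofReal]
  exact_mod_cast this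

/-- The measure `μ` satisfies the Prékopa–Leindler inequality for bounded functions. -/
def PrekopaLeindler {V : Type*} [AddCommGroup V] [Module ℝ V] [MeasurableSpace V]
    (μ : Measure V) : Prop :=
  ∀ ⦃a b : ℝ⦄, 0 < a → 0 < b → a + b = 1 → ∀ ⦃f g h : V → ENNReal⦄, Measurable f → Measurable g →
    Measurable h → ∀ ⦃M : ENNReal⦄, M ≠ ⊤ → (∀ x, f x ≤ M) → (∀ x, g x ≤ M) →
    (∀ x y, f x ^ a * g y ^ b ≤ h (a • x + b • y)) →
    (∫⁻ x, f x ∂μ) ^ a * (∫⁻ x, g x ∂μ) ^ b ≤ ∫⁻ x, h x ∂μ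

open scoped Pointwise in
lemma prekopaLeindler_volume : PrekopaLeindler (volume : Measure ℝ) := by
  intro a b ha hb hab f g h hf hg hh M hM hfM hgM hfgh
  by_cases hf0 : ∫⁻ x, f x = 0
  · simp [hf0, ENNReal.zero_rpow_of_pos ha]
  by_cases hg0 : ∫⁻ x, g x = 0
  · simp [hg0, ENNReal.zero_rpow_of_pos hb]
  have hsup : ∀ f : ℝ → ENNReal, ∫⁻ x, f x ≠ 0 → (∀ x, f x ≤ M) →
      (⨆ x, f x) ≠ 0 ∧ (⨆ x, f x) ≠ ⊤ := by
    refine fun f hf hM' => ⟨fun h => hf ?_, ne_top_of_le_ne_top hM (iSup_le hM')⟩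
    rw [ENNReal.iSup_eq_zero] at h
    simp [h]
  obtain ⟨hF0, hFt⟩ := hsup f hf0 hfM
  obtain ⟨hG0, hGt⟩ := hsup g hg0 hgM
  set F := ⨆ x, f x with hF
  set G := ⨆ x, g x with hG
  have hc0 : F ^ a * G ^ b ≠ 0 := mul_ne_zero (by simp [hF0, hFt]) (by simp [hG0, hGt])
  have hct : F ^ a * G ^ b ≠ ⊤ :=
    ENNReal.mul_ne_top (ENNReal.rpow_ne_top_of_nonneg ha.le hFt)
      (ENNReal.rpow_ne_top_of_nonneg hb.le hGt)
  have hdiv : ∀ (f : ℝ → ENNReal) (C : ENNReal) (t : ℝ), C ≠ 0 → C ≠ ⊤ →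
      {x | ENNReal.ofReal t < C⁻¹ * f x} = {x | ENNReal.ofReal t * C < f x} := by
    intro f C t h0 ht
    ext x
    rw [Set.mem_ofPred_eq, Set.mem_ofPred_eq, mul_comm, ← div_eq_mul_inv,
      ENNReal.lt_div_iff_mul_lt (Or.inl h0) (Or.inl ht)]
  have hne : ∀ f : ℝ → ENNReal, (⨆ x, f x) ≠ 0 → (⨆ x, f x) ≠ ⊤ → ∀ t ∈ Set.Ioo (0 : ℝ) 1,
      {x | ENNReal.ofReal t * (⨆ x, f x) < f x}.Nonempty := by
    intro f h0 htop t ht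
    obtain ⟨x, hx⟩ := lt_iSup_iff.1 (show ENNReal.ofReal t * (⨆ x, f x) < ⨆ x, f x from by
      conv_rhs => rw [← one_mul (⨆ x, f x)]
      exact ENNReal.mul_lt_mul_left h0 htop (by simpa using ht.2))
    exact ⟨x, hx⟩
  have hnorm : ∀ f : ℝ → ENNReal, (⨆ x, f x) ≠ 0 → (⨆ x, f x) ≠ ⊤ → ∀ x,
      min ((⨆ x, f x)⁻¹ * f x) 1 = (⨆ x, f x)⁻¹ * f x := by
    intro f h0 htop x
    refine min_eq_left ?_
    rw [← ENNReal.inv_mul_cancel h0 htop]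
    gcongr
    exact le_iSup f x
  have hlevel : ∀ t ∈ Set.Ioo (0 : ℝ) 1,
      ENNReal.ofReal a * volume {x | ENNReal.ofReal t < F⁻¹ * f x} +
        ENNReal.ofReal b * volume {x | ENNReal.ofReal t < G⁻¹ * g x} ≤
      volume {x | ENNReal.ofReal t < (F ^ a * G ^ b)⁻¹ * h x} := by
    intro t ht
    rw [hdiv f F t hF0 hFt, hdiv g G t hG0 hGt, hdiv h _ t hc0 hct]
    have hv : ∀ (a : ℝ) (A : Set ℝ), 0 < a → ENNReal.ofReal a * volume A = volume (a • A) := by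
      intro a A ha
      rw [Measure.addHaar_smul]
      simp [abs_of_pos ha]
    rw [hv a _ ha, hv b _ hb]
    refine (volume_add_le ((measurableSet_lt measurable_const hf).const_smul₀ a)
      ((measurableSet_lt measurable_const hg).const_smul₀ b) ((hne f hF0 hFt t ht).smul_set)
      ((hne g hG0 hGt t ht).smul_set)).trans (measure_mono ?_)
    rintro _ ⟨_, ⟨x, hx, rfl⟩, _, ⟨y, hy, rfl⟩, rfl⟩
    refine lt_of_lt_of_le ?_ (hfgh x y)
    have ht' : ENNReal.ofReal t = ENNReal.ofReal t ^ a * ENNReal.ofReal t ^ b := by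
      rw [← ENNReal.rpow_add _ _ (by simpa using ht.1) ENNReal.ofReal_ne_top, hab,
        ENNReal.rpow_one]
    rw [ht', mul_mul_mul_comm, ← ENNReal.mul_rpow_of_nonneg _ _ ha.le,
      ← ENNReal.mul_rpow_of_nonneg _ _ hb.le]
    exact ENNReal.mul_lt_mul (ENNReal.rpow_lt_rpow hx ha) (ENNReal.rpow_lt_rpow hy hb)
  calc (∫⁻ x, f x) ^ a * (∫⁻ x, g x) ^ b
      = (F * ∫⁻ x, F⁻¹ * f x) ^ a * (G * ∫⁻ x, G⁻¹ * g x) ^ b := by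
        rw [lintegral_const_mul _ hf, lintegral_const_mul _ hg, ENNReal.mul_inv_cancel_left hF0 hFt,
          ENNReal.mul_inv_cancel_left hG0 hGt]
    _ = (F ^ a * G ^ b) * ((∫⁻ x, F⁻¹ * f x) ^ a * (∫⁻ x, G⁻¹ * g x) ^ b) := by
        rw [ENNReal.mul_rpow_of_nonneg _ _ ha.le, ENNReal.mul_rpow_of_nonneg _ _ hb.le,
          mul_mul_mul_comm]
    _ ≤ (F ^ a * G ^ b) * (ENNReal.ofReal a * (∫⁻ x, F⁻¹ * f x) +
          ENNReal.ofReal b * ∫⁻ x, G⁻¹ * g x) := by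
        gcongr
        exact ENNReal.rpow_mul_rpow_le_add ha hb hab _ _
    _ ≤ (F ^ a * G ^ b) * ∫⁻ x, (F ^ a * G ^ b)⁻¹ * h x := by
        gcongr
        rw [← lintegral_congr (hnorm f hF0 hFt), ← lintegral_congr (hnorm g hG0 hGt),
          lintegral_min_one_eq _ (hf.const_mul _), lintegral_min_one_eq _ (hg.const_mul _),
          ← lintegral_const_mul' _ _ ENNReal.ofReal_ne_top,
          ← lintegral_const_mul' _ _ ENNReal.ofReal_ne_top, ← lintegral_add_left]
        · refine le_trans ?_ (lintegral_mono fun x => min_le_left _ (1 : ENNReal))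
          rw [lintegral_min_one_eq _ (hh.const_mul _)]
          exact setLIntegral_mono' measurableSet_Ioo hlevel
        · refine Measurable.const_mul ?_ _
          exact measurable_measure_prodMk_right (s := {p : ℝ × ℝ | ENNReal.ofReal p.2 < F⁻¹ * f p.1})
            (measurableSet_lt (by fun_prop) (by fun_prop))
    _ = ∫⁻ x, h x := by
        rw [lintegral_const_mul _ hh, ENNReal.mul_inv_cancel_left hc0 hct]

lemma PrekopaLeindler.withDensity {V : Type*} [AddCommGroup V] [Module ℝ V] [MeasurableSpace V]
    {μ : Measure V} (hμ : PrekopaLeindler μ) {φ : V → ENNReal} (hφ : Measurable φ) {C : ENNReal}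
    (hC : C ≠ ⊤) (hφC : ∀ x, φ x ≤ C)
    (hlog : ∀ ⦃a b : ℝ⦄, 0 < a → 0 < b → a + b = 1 → ∀ x y,
      φ x ^ a * φ y ^ b ≤ φ (a • x + b • y)) : PrekopaLeindler (μ.withDensity φ) := by
  intro a b ha hb hab f g h hf hg hh M hM hfM hgM hfgh
  rw [lintegral_withDensity_eq_lintegral_mul _ hφ hf, lintegral_withDensity_eq_lintegral_mul _ hφ hg,
    lintegral_withDensity_eq_lintegral_mul _ hφ hh]
  refine hμ ha hb hab (hφ.mul hf) (hφ.mul hg) (hφ.mul hh) (ENNReal.mul_ne_top hC hM)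
    (fun x => mul_le_mul' (hφC x) (hfM x)) (fun x => mul_le_mul' (hφC x) (hgM x)) fun x y => ?_
  simp only [Pi.mul_apply]
  rw [ENNReal.mul_rpow_of_nonneg _ _ ha.le, ENNReal.mul_rpow_of_nonneg _ _ hb.le,
    mul_mul_mul_comm]
  exact mul_le_mul' (hlog ha hb hab x y) (hfgh x y)

lemma prekopaLeindler_gaussianReal : PrekopaLeindler (gaussianReal 0 1) := by
  rw [gaussianReal_of_var_ne_zero _ one_ne_zero]
  refine prekopaLeindler_volume.withDensity (measurable_gaussianPDF 0 1)
    (C := ENNReal.ofReal (√(2 * Real.pi))⁻¹) ENNReal.ofReal_ne_top (fun x => ?_) ?_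
  · refine ENNReal.ofReal_le_ofReal ?_
    simp only [gaussianPDFReal, NNReal.coe_one, mul_one, sub_zero]
    refine mul_le_of_le_one_right (by positivity) (Real.exp_le_one_iff.2 ?_)
    have := sq_nonneg x
    linarith
  · intro a b ha hb hab x y
    have hpos : ∀ x, 0 < gaussianPDFReal 0 1 x := fun x => gaussianPDFReal_pos 0 1 x one_ne_zero
    simp only [gaussianPDF]
    rw [ENNReal.ofReal_rpow_of_pos (hpos x), ENNReal.ofReal_rpow_of_pos (hpos y),
      ← ENNReal.ofReal_mul (by have := hpos x; positivity)]
    refine ENNReal.ofReal_le_ofReal ?_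
    simp only [gaussianPDFReal, NNReal.coe_one, mul_one, sub_zero, smul_eq_mul]
    have hs : (0 : ℝ) < (√(2 * Real.pi))⁻¹ := by positivity
    rw [Real.mul_rpow hs.le (Real.exp_nonneg _), Real.mul_rpow hs.le (Real.exp_nonneg _),
      mul_mul_mul_comm, ← Real.rpow_add hs, hab, Real.rpow_one, ← Real.exp_mul, ← Real.exp_mul,
      ← Real.exp_add]
    gcongr
    obtain rfl : b = 1 - a := by linarith
    nlinarith [mul_nonneg (mul_nonneg ha.le hb.le) (sq_nonneg (x - y))]

lemma PrekopaLeindler.prod {V W : Type*} [AddCommGroup V] [Module ℝ V] [MeasurableSpace V]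
    [AddCommGroup W] [Module ℝ W] [MeasurableSpace W] {μ : Measure V} {ν : Measure W}
    [SFinite μ] [IsFiniteMeasure ν] (hμ : PrekopaLeindler μ) (hν : PrekopaLeindler ν) :
    PrekopaLeindler (μ.prod ν) := by
  intro a b ha hb hab f g h hf hg hh M hM hfM hgM hfgh
  rw [lintegral_prod _ hf.aemeasurable, lintegral_prod _ hg.aemeasurable,
    lintegral_prod _ hh.aemeasurable]
  have hbd : ∀ f : V × W → ENNReal, (∀ x, f x ≤ M) → ∀ x, ∫⁻ y, f (x, y) ∂ν ≤ M * ν Set.univ :=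
    fun f hf x => (lintegral_mono fun y => hf (x, y)).trans (by simp)
  refine hμ ha hb hab hf.lintegral_prod_right' hg.lintegral_prod_right' hh.lintegral_prod_right'
    (ENNReal.mul_ne_top hM (measure_ne_top ν Set.univ)) (hbd f hfM) (hbd g hgM) fun x x' => ?_
  exact hν ha hb hab (by fun_prop) (by fun_prop) (by fun_prop) hM (fun y => hfM (x, y))
    (fun y => hgM (x', y)) fun y y' => hfgh (x, y) (x', y')

lemma PrekopaLeindler.of_measurePreserving {V W : Type*} [AddCommGroup V] [Module ℝ V]
    [MeasurableSpace V] [AddCommGroup W] [Module ℝ W] [MeasurableSpace W] {μ : Measure V}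
    {ν : Measure W} (hμ : PrekopaLeindler μ) {e : V → W} (he : MeasurePreserving e μ ν)
    (hlin : ∀ (a b : ℝ) (x y : V), e (a • x + b • y) = a • e x + b • e y) :
    PrekopaLeindler ν := by
  intro a b ha hb hab f g h hf hg hh M hM hfM hgM hfgh
  rw [← he.lintegral_comp hf, ← he.lintegral_comp hg, ← he.lintegral_comp hh]
  refine hμ ha hb hab (hf.comp he.measurable) (hg.comp he.measurable) (hh.comp he.measurable) hM
    (fun x => hfM _) (fun x => hgM _) fun x y => ?_
  simp only [hlin]
  exact hfgh _ _

lemma prekopaLeindler_stdPi (n : ℕ) : PrekopaLeindler (stdPi (Fin n)) := by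
  induction n with
  | zero =>
    intro a b ha hb hab f g h hf hg hh M hM hfM hgM hfgh
    rw [stdPi, Measure.pi_of_empty]
    simp only [lintegral_dirac]
    convert hfgh _ _ using 2
  | succ n ih =>
    refine (prekopaLeindler_gaussianReal.prod ih).of_measurePreserving
      (measurePreserving_piFinSuccAbove (fun _ : Fin (n + 1) => gaussianReal 0 1) 0).symm ?_
    intro a b x y
    ext i
    refine Fin.cases ?_ (fun i => ?_) i <;> simp

/-! ### Convex sets in the space of real sequences -/

/-- The standard Gaussian measure on the space of real sequences. -/
noncomputable abbrev stdNat : Measure (ℕ → ℝ) := Measure.infinitePi fun _ => gaussianReal 0 1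

lemma measurePreserving_stdNat_fin (n : ℕ) :
    MeasurePreserving (fun (x : ℕ → ℝ) (i : Fin n) => x i) stdNat (stdPi (Fin n)) := by
  refine ⟨by fun_prop, ?_⟩
  rw [stdNat, Measure.map_infinitePi_infinitePi_of_inj (f := ((↑) : Fin n → ℕ))
    Fin.val_injective, Measure.infinitePi_eq_pi]

lemma measurePreserving_neg_stdNat : MeasurePreserving (fun x : ℕ → ℝ => -x) stdNat stdNat := by
  refine ⟨by fun_prop, ?_⟩
  have := Measure.infinitePi_map_pi (μ := fun _ : ℕ => gaussianReal 0 1) (f := fun _ x => -x)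
    (fun _ => by fun_prop)
  simp only [gaussianReal_map_neg, neg_zero] at this
  exact this

lemma PrekopaLeindler.min_measure_le {V : Type*} [AddCommGroup V] [Module ℝ V]
    [MeasurableSpace V] {μ : Measure V} (hμ : PrekopaLeindler μ) {a b : ℝ} (ha : 0 < a) (hb : 0 < b)
    (hab : a + b = 1) {K L D : Set V} (hK : MeasurableSet K) (hL : MeasurableSet L)
    (hD : MeasurableSet D) (hKL : ∀ x ∈ K, ∀ y ∈ L, a • x + b • y ∈ D) :
    min (μ K) (μ L) ≤ μ D := by
  classical
  have h := hμ ha hb hab (f := K.indicator 1) (g := L.indicator 1) (h := D.indicator 1)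
    (measurable_one.indicator hK) (measurable_one.indicator hL) (measurable_one.indicator hD)
    ENNReal.one_ne_top (Set.indicator_le_self' (by simp)) (Set.indicator_le_self' (by simp))
    fun x y => by
      by_cases hx : x ∈ K
      · by_cases hy : y ∈ L
        · simp [hx, hy, hKL x hx y hy]
        · simp [hy, ENNReal.zero_rpow_of_pos hb]
      · simp [hx, ENNReal.zero_rpow_of_pos ha]
  rw [lintegral_indicator_one hK, lintegral_indicator_one hL, lintegral_indicator_one hD] at h
  refine le_trans ?_ h
  calc min (μ K) (μ L) = min (μ K) (μ L) ^ a * min (μ K) (μ L) ^ b := by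
        rw [← ENNReal.rpow_add_of_nonneg _ _ ha.le hb.le, hab, ENNReal.rpow_one]
    _ ≤ _ := mul_le_mul' (ENNReal.rpow_le_rpow (min_le_left _ _) ha.le)
        (ENNReal.rpow_le_rpow (min_le_right _ _) hb.le)

lemma min_stdNat_le_of_isCompact {a b : ℝ} (ha : 0 < a) (hb : 0 < b) (hab : a + b = 1)
    {K L : Set (ℕ → ℝ)} (hK : IsCompact K) (hL : IsCompact L) :
    min (stdNat K) (stdNat L) ≤ stdNat ((fun p : (ℕ → ℝ) × (ℕ → ℝ) => a • p.1 + b • p.2) '' K ×ˢ L) := by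
  set D := (fun p : (ℕ → ℝ) × (ℕ → ℝ) => a • p.1 + b • p.2) '' K ×ˢ L with hDdef
  have hD : IsCompact D := (hK.prod hL).image (by fun_prop)
  let π : ∀ n : ℕ, (ℕ → ℝ) → Fin n → ℝ := fun n x i => x i
  have hπ : ∀ n, Continuous (π n) := fun n => by fun_prop
  have hDeq : D = ⋂ n, π n ⁻¹' (π n '' D) := by
    refine Set.Subset.antisymm (Set.subset_iInter fun n => Set.subset_preimage_image _ _)
      fun x hx => ?_
    have hx' : ∀ n, ∃ d ∈ D, π n d = π n x := fun n => Set.mem_iInter.1 hx n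
    choose d hd hdx using hx'
    refine hD.isClosed.mem_of_tendsto (b := Filter.atTop) (f := d) ?_ (Filter.Eventually.of_forall hd)
    rw [tendsto_pi_nhds]
    intro i
    refine tendsto_const_nhds.congr' ?_
    filter_upwards [Filter.eventually_gt_atTop i] with n hn
    exact (congrFun (hdx n) ⟨i, hn⟩).symm
  have hlim : Filter.Tendsto (fun n => stdNat (π n ⁻¹' (π n '' D))) Filter.atTop
      (nhds (stdNat D)) := by
    conv_rhs => rw [hDeq]
    refine tendsto_measure_iInter_atTop (fun n => ?_) (fun m n hmn x hx => ?_)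
      ⟨0, measure_ne_top _ _⟩
    · exact ((hD.image (hπ n)).isClosed.preimage (hπ n)).measurableSet.nullMeasurableSet
    · obtain ⟨d, hd, hdx⟩ := hx
      exact ⟨d, hd, funext fun i => congrFun hdx (i.castLE hmn)⟩
  refine ge_of_tendsto' hlim fun n => ?_
  have hmeas : ∀ {C : Set (ℕ → ℝ)}, IsCompact C → MeasurableSet (π n '' C) := fun hC =>
    (hC.image (hπ n)).measurableSet
  have hle : ∀ C : Set (ℕ → ℝ), IsCompact C → stdNat C ≤ stdPi (Fin n) (π n '' C) := fun C hC => by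
    rw [← (measurePreserving_stdNat_fin n).measure_preimage (hmeas hC).nullMeasurableSet]
    exact measure_mono (Set.subset_preimage_image _ _)
  rw [(measurePreserving_stdNat_fin n).measure_preimage (hmeas hD).nullMeasurableSet]
  refine (min_le_min (hle K hK) (hle L hL)).trans
    ((prekopaLeindler_stdPi n).min_measure_le ha hb hab (hmeas hK) (hmeas hL) (hmeas hD) ?_)
  rintro _ ⟨x, hx, rfl⟩ _ ⟨y, hy, rfl⟩
  exact ⟨_, ⟨(x, y), ⟨hx, hy⟩, rfl⟩, rfl⟩

lemma min_stdNat_le {a b : ℝ} (ha : 0 < a) (hb : 0 < b) (hab : a + b = 1)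
    {A B D : Set (ℕ → ℝ)} (hA : MeasurableSet A) (hB : MeasurableSet B)
    (hAB : ∀ x ∈ A, ∀ y ∈ B, a • x + b • y ∈ D) : min (stdNat A) (stdNat B) ≤ stdNat D := by
  refine le_of_forall_lt fun r hr => ?_
  obtain ⟨K, hKA, hK, hrK⟩ := hA.exists_lt_isCompact_of_ne_top (measure_ne_top _ _)
    (hr.trans_le (min_le_left _ _))
  obtain ⟨L, hLB, hL, hrL⟩ := hB.exists_lt_isCompact_of_ne_top (measure_ne_top _ _)
    (hr.trans_le (min_le_right _ _))
  refine (lt_min hrK hrL).trans_le ((min_stdNat_le_of_isCompact ha hb hab hK hL).trans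
    (measure_mono ?_))
  rintro _ ⟨⟨x, y⟩, ⟨hx, hy⟩, rfl⟩
  exact hAB x (hKA hx) y (hLB hy)

/-- The sequence with the given first `n` coordinates, and the other ones taken from `t`. -/
def glueSeq (n : ℕ) (p : (Fin n → ℝ) × (ℕ → ℝ)) : ℕ → ℝ :=
  fun i => if h : i < n then p.1 ⟨i, h⟩ else p.2 i

lemma measurable_glueSeq (n : ℕ) : Measurable (glueSeq n) := by
  refine measurable_pi_lambda _ fun i => ?_
  by_cases h : i < n
  · simp only [glueSeq, h, dite_true]; fun_prop
  · simp only [glueSeq, h, dite_false]; fun_prop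

lemma glueSeq_combo (n : ℕ) (a b : ℝ) (p q : (Fin n → ℝ) × (ℕ → ℝ)) :
    glueSeq n (a • p + b • q) = a • glueSeq n p + b • glueSeq n q := by
  ext i
  by_cases h : i < n <;> simp [glueSeq, h]

lemma glueSeq_neg (n : ℕ) (p : (Fin n → ℝ) × (ℕ → ℝ)) : glueSeq n (-p) = -glueSeq n p := by
  ext i
  by_cases h : i < n <;> simp [glueSeq, h]

lemma measurePreserving_glueSeq (n : ℕ) :
    MeasurePreserving (glueSeq n) ((stdPi (Fin n)).prod stdNat) stdNat := by
  classical
  refine ⟨measurable_glueSeq n, Measure.eq_infinitePi _ fun s t ht => ?_⟩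
  rw [Measure.map_apply (measurable_glueSeq n)
    (MeasurableSet.pi s.countable_toSet fun i _ => ht i)]
  have : glueSeq n ⁻¹' Set.pi s t =
      (Set.univ.pi fun i : Fin n => if (i : ℕ) ∈ s then t i else Set.univ) ×ˢ
        Set.pi ↑(s.filter fun i => ¬ i < n) t := by
    ext p
    simp only [Set.mem_preimage, Set.mem_pi, Set.mem_prod, glueSeq, Finset.mem_coe,
      Finset.mem_filter, Set.mem_univ, true_imp_iff]
    constructor
    · intro h
      refine ⟨fun i => ?_, fun i hi => ?_⟩
      · split_ifs with hi
        · simpa using h i hi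
        · trivial
      · simpa [hi.2] using h i hi.1
    · rintro ⟨h1, h2⟩ i hi
      by_cases hin : i < n
      · simpa [hin, hi] using h1 ⟨i, hin⟩
      · simpa [hin] using h2 i ⟨hi, hin⟩
  rw [this, Measure.prod_prod, Measure.pi_pi, Measure.infinitePi_pi _ fun i _ => ht i,
    ← Finset.prod_filter_mul_prod_filter_not s fun i => i < n]
  congr 1
  have h1 : ∀ i : Fin n, gaussianReal 0 1 (if (i : ℕ) ∈ s then t i else Set.univ) =
      (fun j : ℕ => if j ∈ s then gaussianReal 0 1 (t j) else 1) i := by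
    intro i
    by_cases hi : (i : ℕ) ∈ s <;> simp [hi]
  rw [Finset.prod_congr rfl fun i _ => h1 i, Fin.prod_univ_eq_prod_range
    (fun j => if j ∈ s then gaussianReal 0 1 (t j) else 1) n, Finset.prod_ite_mem]
  refine Finset.prod_congr ?_ fun _ _ => rfl
  ext i
  simp [and_comm]

/-- The conditional probability of `A` given the first `n` coordinates. -/
noncomputable def sectionMeasure (A : Set (ℕ → ℝ)) (n : ℕ) (y : Fin n → ℝ) : ENNReal :=
  stdNat ((fun t => glueSeq n (y, t)) ⁻¹' A)

lemma sectionMeasure_ne_top (A : Set (ℕ → ℝ)) (n : ℕ) (y : Fin n → ℝ) :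
    sectionMeasure A n y ≠ ⊤ := measure_ne_top _ _

lemma measurable_sectionMeasure {A : Set (ℕ → ℝ)} (hA : MeasurableSet A) (n : ℕ) :
    Measurable (sectionMeasure A n) :=
  measurable_measure_prodMk_left (hA.preimage (measurable_glueSeq n))

lemma lintegral_sectionMeasure {A : Set (ℕ → ℝ)} (hA : MeasurableSet A) (n : ℕ) :
    ∫⁻ y, sectionMeasure A n y ∂(stdPi (Fin n)) = stdNat A := by
  rw [← (measurePreserving_glueSeq n).measure_preimage hA.nullMeasurableSet,
    Measure.prod_apply (hA.preimage (measurable_glueSeq n))]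
  rfl

lemma isSymmQuasiconcave_sectionMeasure {A : Set (ℕ → ℝ)} (hA : MeasurableSet A)
    (hAc : Convex ℝ A) (hAs : ∀ x ∈ A, -x ∈ A) (n : ℕ) :
    IsSymmQuasiconcave fun y => (sectionMeasure A n y).toReal := by
  have hms : ∀ y : Fin n → ℝ, MeasurableSet ((fun t => glueSeq n (y, t)) ⁻¹' A) := fun y =>
    hA.preimage ((measurable_glueSeq n).comp measurable_prodMk_left)
  refine ⟨(measurable_sectionMeasure hA n).ennreal_toReal, fun y => ?_, fun c => ?_⟩
  · congr 1
    rw [sectionMeasure, sectionMeasure,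
      ← measurePreserving_neg_stdNat.measure_preimage (hms (-y)).nullMeasurableSet]
    congr 1
    ext t
    have h : glueSeq n (-y, -t) = -glueSeq n (y, t) := glueSeq_neg n (y, t)
    simp only [Set.mem_preimage, h]
    exact ⟨fun h => by simpa using hAs _ h, hAs _⟩
  · rw [convex_iff_forall_pos]
    intro x hx y hy a b ha hb hab
    rw [Set.mem_ofPred_eq] at hx hy ⊢
    refine (le_min hx hy).trans ?_
    rw [← ENNReal.toReal_min (sectionMeasure_ne_top _ _ _) (sectionMeasure_ne_top _ _ _)]
    refine ENNReal.toReal_mono (sectionMeasure_ne_top _ _ _)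
      (min_stdNat_le ha hb hab (hms x) (hms y) fun t ht t' ht' => ?_)
    have := glueSeq_combo n a b (x, t) (y, t')
    simp only [Prod.smul_mk, Prod.mk_add_mk] at this
    simp only [Set.mem_preimage, this]
    exact hAc ht ht' ha.le hb.le hab

open scoped symmDiff in
lemma exists_finset_cylinder_approx {A : Set (ℕ → ℝ)} (hA : MeasurableSet A) {ε : ENNReal}
    (hε : 0 < ε) : ∃ C : Set (ℕ → ℝ), MeasurableSet C ∧ stdNat (A \ C) ≤ ε ∧ stdNat (C \ A) ≤ ε ∧
      ∃ N, ∀ x y : ℕ → ℝ, (∀ i < N, x i = y i) → x ∈ C → y ∈ C := by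
  obtain ⟨C, hC, hCA⟩ := exists_measure_symmDiff_lt_of_generateFrom_isSetRing (μ := stdNat)
    (C := measurableCylinders fun _ : ℕ => ℝ) isSetRing_measurableCylinders
    ⟨{Set.univ}, Set.countable_singleton _, 
      Set.singleton_subset_iff.2 (univ_mem_measurableCylinders _), by simp⟩
    generateFrom_measurableCylinders.symm hA hε
  refine ⟨C, .of_mem_measurableCylinders hC, (measure_mono ?_).trans hCA.le,
    (measure_mono ?_).trans hCA.le, ?_⟩
  · exact Set.subset_union_right
  · exact Set.subset_union_left
  · obtain ⟨s, S, -, rfl⟩ := (mem_measurableCylinders _).1 hC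
    refine ⟨s.sup id + 1, fun x y hxy hx => ?_⟩
    rw [mem_cylinder] at hx ⊢
    convert hx using 1
    ext i
    exact (hxy i (Nat.lt_succ_of_le (Finset.le_sup (f := id) i.2))).symm

lemma sectionMeasure_le_indicator_add {A C : Set (ℕ → ℝ)} {n : ℕ}
    (hC : ∀ x y : ℕ → ℝ, (∀ i < n, x i = y i) → x ∈ C → y ∈ C) (y : Fin n → ℝ) :
    sectionMeasure A n y ≤
      Set.indicator {y | glueSeq n (y, 0) ∈ C} 1 y + sectionMeasure (A \ C) n y := by
  by_cases hy : glueSeq n (y, 0) ∈ C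
  · refine le_add_right ?_
    rw [Set.indicator_of_mem (by exact hy)]
    exact prob_le_one
  · refine le_add_left (measure_mono fun t ht => ⟨ht, fun htC => hy ?_⟩)
    refine hC _ _ (fun i hi => ?_) htC
    simp [glueSeq, hi]

lemma stdPi_glueSeq_zero_mem {C : Set (ℕ → ℝ)} (hCm : MeasurableSet C) {n : ℕ}
    (hC : ∀ x y : ℕ → ℝ, (∀ i < n, x i = y i) → x ∈ C → y ∈ C) :
    stdPi (Fin n) {y | glueSeq n (y, 0) ∈ C} = stdNat C := by
  have hm : MeasurableSet {y | glueSeq n (y, 0) ∈ C} :=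
    hCm.preimage ((measurable_glueSeq n).comp measurable_prodMk_right)
  rw [← (measurePreserving_stdNat_fin n).measure_preimage hm.nullMeasurableSet]
  congr 1
  ext x
  exact ⟨hC _ _ fun i hi => by simp [glueSeq, hi], hC _ _ fun i hi => by simp [glueSeq, hi]⟩

lemma correlatesSymmConvex_stdNat : CorrelatesSymmConvex stdNat := by
  intro A B hA hB hAc hBc hAs hBs
  refine ENNReal.le_of_forall_pos_le_add fun ε hε _ => ?_
  have hε' : (0 : ENNReal) < ε / 4 := by simpa using hε.ne'
  obtain ⟨C, hC, hAC, hCA, N, hCN⟩ := exists_finset_cylinder_approx hA hε'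
  obtain ⟨D, hD, hBD, hDB, N', hDN⟩ := exists_finset_cylinder_approx hB hε'
  set n := max N N'
  have hCn : ∀ x y : ℕ → ℝ, (∀ i < n, x i = y i) → x ∈ C → y ∈ C := fun x y h =>
    hCN x y fun i hi => h i (hi.trans_le (le_max_left _ _))
  have hDn : ∀ x y : ℕ → ℝ, (∀ i < n, x i = y i) → x ∈ D → y ∈ D := fun x y h =>
    hDN x y fun i hi => h i (hi.trans_le (le_max_right _ _))
  have hCDn : ∀ x y : ℕ → ℝ, (∀ i < n, x i = y i) → x ∈ C ∩ D → y ∈ C ∩ D := fun x y h hx =>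
    ⟨hCn x y h hx.1, hDn x y h hx.2⟩
  have hm : ∀ {E : Set (ℕ → ℝ)}, MeasurableSet E → MeasurableSet {y | glueSeq n (y, 0) ∈ E} :=
    fun hE => hE.preimage ((measurable_glueSeq n).comp measurable_prodMk_right)
  have key := (correlatesSymmConvex_stdPi n).lintegral_prod_mul_le (ι := Unit) (κ := Unit)
    (fun _ => isSymmQuasiconcave_sectionMeasure hA hAc hAs n)
    (fun _ => isSymmQuasiconcave_sectionMeasure hB hBc hBs n)
  simp only [Finset.univ_unique, Finset.prod_singleton,
    ENNReal.ofReal_toReal (sectionMeasure_ne_top _ _ _), lintegral_sectionMeasure hA,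
    lintegral_sectionMeasure hB] at key
  have hpt : ∀ y, sectionMeasure A n y * sectionMeasure B n y ≤
      Set.indicator {y | glueSeq n (y, 0) ∈ C ∩ D} 1 y +
        (sectionMeasure (A \ C) n y + sectionMeasure (B \ D) n y) := by
    intro y
    have hA1 : sectionMeasure A n y ≤ 1 := prob_le_one
    have hi1 : Set.indicator {y | glueSeq n (y, 0) ∈ D} (1 : (Fin n → ℝ) → ENNReal) y ≤ 1 :=
      Set.indicator_le_self' (by simp) y
    calc sectionMeasure A n y * sectionMeasure B n y
        ≤ sectionMeasure A n y * (Set.indicator {y | glueSeq n (y, 0) ∈ D} 1 y +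
            sectionMeasure (B \ D) n y) := by
          gcongr; exact sectionMeasure_le_indicator_add hDn y
      _ ≤ sectionMeasure A n y * Set.indicator {y | glueSeq n (y, 0) ∈ D} 1 y +
            sectionMeasure (B \ D) n y := by
          rw [mul_add]; gcongr; exact mul_le_of_le_one_left' hA1
      _ ≤ (Set.indicator {y | glueSeq n (y, 0) ∈ C} 1 y + sectionMeasure (A \ C) n y) *
            Set.indicator {y | glueSeq n (y, 0) ∈ D} 1 y + sectionMeasure (B \ D) n y := by
          gcongr; exact sectionMeasure_le_indicator_add hCn y
      _ ≤ Set.indicator {y | glueSeq n (y, 0) ∈ C} 1 y *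
            Set.indicator {y | glueSeq n (y, 0) ∈ D} 1 y + sectionMeasure (A \ C) n y +
            sectionMeasure (B \ D) n y := by
          rw [add_mul]; gcongr; exact mul_le_of_le_one_right' hi1
      _ = _ := by
          rw [add_assoc]
          congr 1
          by_cases h : glueSeq n (y, 0) ∈ C <;> by_cases h' : glueSeq n (y, 0) ∈ D <;>
            simp [h, h']
  have hsub : C ∩ D ⊆ (A ∩ B) ∪ ((C \ A) ∪ (D \ B)) := by
    intro x hx
    by_cases h : x ∈ A
    · by_cases h' : x ∈ B
      · exact Or.inl ⟨h, h'⟩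
      · exact Or.inr (Or.inr ⟨hx.2, h'⟩)
    · exact Or.inr (Or.inl ⟨hx.1, h⟩)
  calc stdNat A * stdNat B ≤ _ := key
    _ ≤ _ := lintegral_mono hpt
    _ = stdNat (C ∩ D) + (stdNat (A \ C) + stdNat (B \ D)) := by
        rw [lintegral_add_left (measurable_one.indicator (hm (hC.inter hD))),
          lintegral_add_left (measurable_sectionMeasure (hA.diff hC) n),
          lintegral_indicator_one (hm (hC.inter hD)), lintegral_sectionMeasure (hA.diff hC),
          lintegral_sectionMeasure (hB.diff hD), stdPi_glueSeq_zero_mem (hC.inter hD) hCDn]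
    _ ≤ (stdNat (A ∩ B) + (ε / 4 + ε / 4)) + (ε / 4 + ε / 4) := by
        gcongr
        exact (measure_mono hsub).trans ((measure_union_le _ _).trans (add_le_add le_rfl
          ((measure_union_le _ _).trans (add_le_add hCA hDB))))
    _ = stdNat (A ∩ B) + ε := by
        rw [add_assoc]
        congr 1
        have h4 : (ε : ENNReal) / 4 = ε / 2 / 2 := by
          rw [div_eq_mul_inv, div_eq_mul_inv, div_eq_mul_inv, mul_assoc,
            ← ENNReal.mul_inv (by simp) (by simp)]
          norm_num
        rw [h4, ENNReal.add_halves, ENNReal.add_halves]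

/-! ### Reduction to sequences of independent Gaussians -/

/-- Sequences in an inner product space have a lower triangular Cholesky factorisation. -/
lemma exists_norm_sq_sum_eq {E : Type*} [NormedAddCommGroup E] [InnerProductSpace ℝ E]
    (f : ℕ → E) : ∃ c : ℕ → ℕ → ℝ, (∀ i j, i < j → c i j = 0) ∧ ∀ (N : ℕ) (a : ℕ → ℝ),
      ‖∑ i ∈ Finset.range N, a i • f i‖ ^ 2 =
        ∑ j ∈ Finset.range N, (∑ i ∈ Finset.range N, a i * c i j) ^ 2 := by
  set g := InnerProductSpace.gramSchmidt ℝ f with hg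
  set c : ℕ → ℕ → ℝ := fun i j => inner ℝ (g j) (f i) / ‖g j‖ with hc
  have htri : ∀ i j, i < j → c i j = 0 := fun i j hij => by
    simp [hc, hg, InnerProductSpace.gramSchmidt_inv_triangular ℝ f hij]
  have hdiag : ∀ i, inner ℝ (g i) (f i) = ‖g i‖ ^ 2 := fun i => by
    conv_lhs => rw [InnerProductSpace.gramSchmidt_def'' ℝ f i]
    rw [inner_add_right, inner_sum, real_inner_self_eq_norm_sq, Finset.sum_eq_zero, add_zero]
    intro j hj
    rw [inner_smul_right, InnerProductSpace.gramSchmidt_orthogonal ℝ f (Finset.mem_Iio.1 hj).ne',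
      mul_zero]
  have hf : ∀ N, ∀ i < N, f i = ∑ j ∈ Finset.range N, (c i j / ‖g j‖) • g j := by
    intro N i hi
    rw [← Finset.sum_subset (Finset.range_mono (Nat.succ_le_of_lt hi)) (fun j _ hj => by
      rw [htri i j (by simpa using hj)]; simp), Finset.sum_range_succ, add_comm]
    conv_lhs => rw [InnerProductSpace.gramSchmidt_def'' ℝ f i]
    rw [Nat.Iio_eq_range]
    congr 1
    · by_cases h : g i = 0
      · simp [← hg, h]
      · have : ‖g i‖ ≠ 0 := norm_ne_zero_iff.2 h
        simp only [hc, hdiag]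
        rw [show ‖g i‖ ^ 2 / ‖g i‖ / ‖g i‖ = 1 by field_simp, one_smul]
    · refine Finset.sum_congr rfl fun j _ => ?_
      simp [hc, ← hg, div_div, sq]
  refine ⟨c, htri, fun N a => ?_⟩
  have h1 : ∑ i ∈ Finset.range N, a i • f i =
      ∑ j ∈ Finset.range N, ((∑ i ∈ Finset.range N, a i * c i j) / ‖g j‖) • g j := by
    rw [Finset.sum_congr rfl fun i hi => by rw [hf N i (Finset.mem_range.1 hi)]]
    simp_rw [Finset.smul_sum, smul_smul]
    rw [Finset.sum_comm]
    simp_rw [Finset.sum_div, Finset.sum_smul, mul_div_assoc]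
  rw [h1, ← real_inner_self_eq_norm_sq, sum_inner]
  refine Finset.sum_congr rfl fun j hj => ?_
  rw [inner_sum, Finset.sum_eq_single j]
  · rw [inner_smul_left, inner_smul_right, real_inner_self_eq_norm_sq]
    by_cases h : ‖g j‖ = 0
    · simp [hc, h]
    · simp only [conj_trivial]
      field_simp
  · intro k _ hk
    rw [inner_smul_left, inner_smul_right, InnerProductSpace.gramSchmidt_orthogonal ℝ f hk.symm]
    simp
  · exact fun h => absurd hj h

/-- A finite measure on `ℕ → ℝ` is determined by its characteristic functions on finitely many
coordinates. -/
lemma Measure.ext_of_integral_exp_sum {P Q : Measure (ℕ → ℝ)} [IsFiniteMeasure P]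
    [IsFiniteMeasure Q] (h : ∀ (N : ℕ) (a : ℕ → ℝ),
      ∫ y, Complex.exp ((∑ i ∈ Finset.range N, a i * y i : ℝ) * Complex.I) ∂P =
        ∫ y, Complex.exp ((∑ i ∈ Finset.range N, a i * y i : ℝ) * Complex.I) ∂Q) : P = Q := by
  classical
  refine IsProjectiveLimit.unique (P := fun I => Q.map I.restrict) (fun I => ?_) fun I => rfl
  have hr : Measurable (I.restrict (π := fun _ : ℕ => ℝ)) := Finset.measurable_restrict I
  refine Measure.ext_of_charFunDual (funext fun ℓ => ?_)
  obtain ⟨N, hN⟩ : ∃ N, I ⊆ Finset.range N := I.exists_nat_subset_range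
  set a : ℕ → ℝ := fun i => if hi : i ∈ I then ℓ (Pi.single ⟨i, hi⟩ 1) else 0 with ha
  have hℓ : ∀ y : ℕ → ℝ, ℓ (I.restrict y) = ∑ i ∈ Finset.range N, a i * y i := by
    intro y
    rw [← Finset.sum_subset hN (fun i _ hi => by simp [ha, hi]), ← Finset.sum_coe_sort I]
    conv_lhs => rw [← Finset.univ_sum_single (I.restrict y), map_sum]
    refine Finset.sum_congr rfl fun i _ => ?_
    have : (Pi.single i (I.restrict y i) : I → ℝ) = y i • Pi.single i (1 : ℝ) := by
      rw [← Pi.single_smul]; simp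
    rw [this, map_smul]
    simp [ha, mul_comm]
  rw [charFunDual_apply, charFunDual_apply, integral_map hr.aemeasurable (by fun_prop),
    integral_map hr.aemeasurable (by fun_prop)]
  simpa only [hℓ] using h N a

lemma integral_exp_sum_stdNat (N : ℕ) (b : ℕ → ℝ) :
    ∫ z, Complex.exp ((∑ j ∈ Finset.range N, b j * z j : ℝ) * Complex.I) ∂stdNat =
      Complex.exp ((-(∑ j ∈ Finset.range N, b j ^ 2) / 2 : ℝ)) := by
  set F : (Fin N → ℝ) → ℂ := fun x => ∏ j : Fin N, Complex.exp (b j * x j * Complex.I) with hF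
  have hFz : ∀ z : ℕ → ℝ, Complex.exp ((∑ j ∈ Finset.range N, b j * z j : ℝ) * Complex.I) =
      F fun j => z j := fun z => by
    simp only [hF]
    rw [← Complex.exp_sum, Finset.sum_range]
    push_cast
    rw [Finset.sum_mul]
  have hmp := measurePreserving_stdNat_fin N
  rw [integral_congr_ae (.of_forall hFz), ← integral_map (f := F) hmp.measurable.aemeasurable
    (by fun_prop), hmp.map_eq,
    integral_fintype_prod_eq_prod (𝕜 := ℂ) (f := fun (j : Fin N) (x : ℝ) =>
      Complex.exp (b j * x * Complex.I))]
  simp_rw [← charFun_apply_real, charFun_gaussianReal]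
  rw [← Complex.exp_sum, Finset.sum_range]
  push_cast
  rw [neg_div, Finset.sum_div, ← Finset.sum_neg_distrib]
  simp

lemma IsCenteredGaussian.memLp {X : Type*} [NormedAddCommGroup X] [NormedSpace ℝ X]
    [MeasurableSpace X] [BorelSpace X] {μ : Measure X} (hμ : IsCenteredGaussian μ)
    (L : X →L[ℝ] ℝ) : MemLp L 2 μ := by
  obtain ⟨v, hv⟩ := hμ.2 L
  have := memLp_id_gaussianReal (μ := 0) (v := v) 2
  rw [← hv] at this
  exact (memLp_map_measure_iff (by fun_prop) L.continuous.aemeasurable).1 this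

lemma IsCenteredGaussian.integral_exp {X : Type*} [NormedAddCommGroup X] [NormedSpace ℝ X]
    [MeasurableSpace X] [BorelSpace X] {μ : Measure X} (hμ : IsCenteredGaussian μ)
    (L : X →L[ℝ] ℝ) :
    ∫ x, Complex.exp (L x * Complex.I) ∂μ = Complex.exp ((-(∫ x, L x ^ 2 ∂μ) / 2 : ℝ)) := by
  obtain ⟨v, hv⟩ := hμ.2 L
  have hL : AEMeasurable L μ := L.continuous.aemeasurable
  have h2 : ∫ x, L x ^ 2 ∂μ = v := by
    rw [← integral_map (f := fun t : ℝ => t ^ 2) hL (by fun_prop), hv]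
    have := variance_id_gaussianReal (μ := 0) (v := v)
    rwa [variance_of_integral_eq_zero aemeasurable_id (by simp)] at this
  rw [h2, ← integral_map (f := fun t : ℝ => Complex.exp (t * Complex.I)) hL (by fun_prop), hv]
  have := charFun_gaussianReal (μ := 0) (v := v) 1
  rw [charFun_apply_real] at this
  simpa [neg_div] using this

lemma coeFn_sum_smul_toLp {α ι : Type*} [MeasurableSpace α] {μ : Measure α} {p : ENNReal}
    {f : ι → α → ℝ} (hf : ∀ i, MemLp (f i) p μ) (a : ι → ℝ) (s : Finset ι) :
    (∑ i ∈ s, a i • (hf i).toLp : Lp ℝ p μ) =ᵐ[μ] fun x => ∑ i ∈ s, a i * f i x := by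
  classical
  induction s using Finset.induction_on with
  | empty => simp only [Finset.sum_empty]; exact Lp.coeFn_zero ℝ p μ
  | insert k s hk ih =>
    rw [Finset.sum_insert hk]
    filter_upwards [ih, Lp.coeFn_add (a k • (hf k).toLp) (∑ i ∈ s, a i • (hf i).toLp),
      Lp.coeFn_smul (a k) (hf k).toLp, (hf k).coeFn_toLp] with x h1 h2 h3 h4
    rw [h2, Pi.add_apply, h1, h3, Pi.smul_apply, h4, Finset.sum_insert hk, smul_eq_mul]

lemma exists_seq_dual_separating (X : Type*) [NormedAddCommGroup X] [NormedSpace ℝ X]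
    [TopologicalSpace.SeparableSpace X] :
    ∃ L : ℕ → X →L[ℝ] ℝ, Function.Injective fun (x : X) (n : ℕ) => L n x := by
  choose L hL1 hL using fun n => exists_dual_vector'' ℝ (TopologicalSpace.denseSeq X n)
  refine ⟨L, fun x y hxy => sub_eq_zero.1 (norm_eq_zero.1 ?_)⟩
  have h0 : ∀ n, L n (x - y) = 0 := fun n => by
    rw [map_sub, sub_eq_zero]; exact congrFun hxy n
  refine le_antisymm (le_of_forall_pos_le_add fun ε hε => ?_) (norm_nonneg _)
  obtain ⟨n, hn⟩ := (TopologicalSpace.denseRange_denseSeq X).exists_dist_lt (x - y) (half_pos hε)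
  set d := TopologicalSpace.denseSeq X n
  rw [dist_eq_norm, norm_sub_rev] at hn
  have hd : ‖d‖ ≤ ‖d - (x - y)‖ := by
    have h1 : L n (d - (x - y)) = ‖d‖ := by rw [map_sub, h0, sub_zero]; exact hL n
    calc ‖d‖ = ‖L n (d - (x - y))‖ := by rw [h1, norm_norm]
      _ ≤ ‖L n‖ * ‖d - (x - y)‖ := (L n).le_opNorm _
      _ ≤ _ := mul_le_of_le_one_left (norm_nonneg _) (hL1 n)
  have := norm_sub_norm_le (x - y) d
  rw [norm_sub_rev (x - y) d] at this
  linarith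

/-- Coordinates of a centered Gaussian measure are jointly distributed as linear functions of
a sequence of independent standard Gaussians. -/
lemma IsCenteredGaussian.exists_map_eq {X : Type*} [NormedAddCommGroup X] [NormedSpace ℝ X]
    [MeasurableSpace X] [BorelSpace X] {μ : Measure X} (hμ : IsCenteredGaussian μ)
    (L : ℕ → X →L[ℝ] ℝ) : ∃ T : (ℕ → ℝ) →ₗ[ℝ] (ℕ → ℝ), Measurable T ∧
      μ.map (fun x n => L n x) = stdNat.map T := by
  have := hμ.1
  obtain ⟨c, hc, hcsum⟩ := exists_norm_sq_sum_eq fun n => (hμ.memLp (L n)).toLp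
  set T : (ℕ → ℝ) →ₗ[ℝ] (ℕ → ℝ) := LinearMap.pi fun n =>
    ∑ j ∈ Finset.range (n + 1), c n j • LinearMap.proj j with hT
  have hTapp : ∀ N, ∀ n < N, ∀ z, T z n = ∑ j ∈ Finset.range N, c n j * z j := by
    intro N n hn z
    rw [← Finset.sum_subset (Finset.range_mono (Nat.succ_le_of_lt hn)) (fun j _ hj => by
      rw [hc n j (by simpa using hj), zero_mul])]
    simp [hT]
  have hTm : Measurable T := measurable_pi_iff.2 fun n => by
    simp_rw [hTapp (n + 1) n n.lt_succ_self]; fun_prop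
  have hΦ : Measurable fun (x : X) (n : ℕ) => L n x :=
    measurable_pi_iff.2 fun n => (L n).continuous.measurable
  refine ⟨T, hTm, ?_⟩
  have := Measure.isProbabilityMeasure_map (μ := μ) hΦ.aemeasurable
  have := Measure.isProbabilityMeasure_map (μ := stdNat) hTm.aemeasurable
  refine Measure.ext_of_integral_exp_sum fun N a => ?_
  have hexp : Measurable fun y : ℕ → ℝ =>
      Complex.exp ((∑ i ∈ Finset.range N, a i * y i : ℝ) * Complex.I) := by
    have : Measurable fun y : ℕ → ℝ => ∑ i ∈ Finset.range N, a i * y i := by fun_prop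
    exact ((Complex.measurable_ofReal.comp this).mul_const _).cexp
  rw [integral_map hΦ.aemeasurable hexp.aestronglyMeasurable,
    integral_map hTm.aemeasurable hexp.aestronglyMeasurable]
  have h1 : ∀ z, ∑ i ∈ Finset.range N, a i * T z i =
      ∑ j ∈ Finset.range N, (∑ i ∈ Finset.range N, a i * c i j) * z j := by
    intro z
    rw [Finset.sum_congr rfl fun i hi => by rw [hTapp N i (Finset.mem_range.1 hi)]]
    simp_rw [Finset.mul_sum, Finset.sum_mul]
    rw [Finset.sum_comm]
    simp_rw [mul_assoc]
  have h2 : ∀ x, ∑ i ∈ Finset.range N, a i * L i x = (∑ i ∈ Finset.range N, a i • L i) x := by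
    intro x; simp
  have h3 : ∫ x, (∑ i ∈ Finset.range N, a i • L i) x ^ 2 ∂μ =
      ‖∑ i ∈ Finset.range N, a i • (hμ.memLp (L i)).toLp‖ ^ 2 := by
    rw [← real_inner_self_eq_norm_sq, L2.inner_def]
    refine integral_congr_ae ?_
    filter_upwards [coeFn_sum_smul_toLp (fun i => hμ.memLp (L i)) a _] with x hx
    rw [hx]
    simp [sq]
  simp_rw [h1, integral_exp_sum_stdNat, h2]
  rw [hμ.integral_exp, h3, hcsum]

lemma IsCenteredGaussian.correlatesSymmConvex {X : Type*} [NormedAddCommGroup X]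
    [NormedSpace ℝ X] [CompleteSpace X] [TopologicalSpace.SeparableSpace X]
    [MeasurableSpace X] [BorelSpace X] {μ : Measure X} (hμ : IsCenteredGaussian μ) :
    CorrelatesSymmConvex μ := by
  obtain ⟨L, hL⟩ := exists_seq_dual_separating X
  obtain ⟨T, hTm, hT⟩ := hμ.exists_map_eq L
  have : SecondCountableTopology X := UniformSpace.secondCountable_of_separable X
  set Φ : X →ₗ[ℝ] (ℕ → ℝ) := LinearMap.pi fun n => (L n : X →ₗ[ℝ] ℝ)
  have hΦinj : Function.Injective Φ := hL
  have hΦ : MeasurableEmbedding Φ :=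
    (continuous_pi fun n => (L n).continuous).measurableEmbedding hΦinj
  have key : ∀ A, MeasurableSet A → μ A = stdNat (T ⁻¹' (Φ '' A)) := fun A hA => by
    rw [← Measure.map_apply hTm (hΦ.measurableSet_image.2 hA), ← hT]
    change μ A = μ.map Φ (Φ '' A)
    rw [hΦ.map_apply, hΦinj.preimage_image]
  have hneg : ∀ A : Set X, (∀ x ∈ A, -x ∈ A) →
      ∀ z ∈ T ⁻¹' (Φ '' A), -z ∈ T ⁻¹' (Φ '' A) := by
    rintro A hA z ⟨x, hx, hxz⟩
    exact ⟨-x, hA x hx, by rw [map_neg, map_neg, hxz]⟩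
  intro A B hA hB hAc hBc hAs hBs
  rw [key A hA, key B hB, key _ (hA.inter hB), Set.image_inter hΦinj, Set.preimage_inter]
  exact correlatesSymmConvex_stdNat _ _ (hTm (hΦ.measurableSet_image.2 hA))
    (hTm (hΦ.measurableSet_image.2 hB)) ((hAc.linear_image Φ).linear_preimage T)
    ((hBc.linear_image Φ).linear_preimage T) (hneg A hAs) (hneg B hBs)

lemma IsSymmQuasiconcave.le_zero {V : Type*} [AddCommGroup V] [Module ℝ V] [MeasurableSpace V]
    {f : V → ℝ} (hf : IsSymmQuasiconcave f) (x : V) : f x ≤ f 0 := by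
  have h := hf.convex (f x) (show f x ≤ f x from le_rfl) (show f x ≤ f (-x) from (hf.symm x).ge)
    (a := 1 / 2) (b := 1 / 2) (by norm_num) (by norm_num) (by norm_num)
  rwa [smul_neg, add_neg_cancel] at h

/-- functional form of the Gaussian correlation inequality.
Let `μ` be a centered Gaussian measure on a real separable Banach space `X` and
`f 0, …, f (n-1) : X → [0,∞)` symmetric quasi-concave functions.  Then for `1 ≤ m < n`,
`(∫ ∏_{i<m} f i dμ) · (∫ ∏_{m≤j<n} f j dμ) ≤ μ(X) · ∫ ∏_{i<n} f i dμ`. -/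
theorem gci_functional {X : Type*} [NormedAddCommGroup X] [NormedSpace ℝ X]
    [CompleteSpace X] [TopologicalSpace.SeparableSpace X]
    [MeasurableSpace X] [BorelSpace X]
    (μ : Measure X) (hμ : IsCenteredGaussian μ)
    (n m : ℕ) (hm : 1 ≤ m) (hmn : m < n)
    (f : ℕ → X → ℝ)
    (hmeas : ∀ i, i < n → Measurable (f i))
    (hnonneg : ∀ i, i < n → ∀ x, 0 ≤ f i x)
    (hsymm : ∀ i, i < n → ∀ x, f i (-x) = f i x)
    (hqc : ∀ i, i < n → ∀ c : ℝ, Convex ℝ {x | c ≤ f i x}) :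
    (∫ x, ∏ i ∈ Finset.range m, f i x ∂μ) * (∫ x, ∏ j ∈ Finset.Ico m n, f j x ∂μ)
      ≤ (μ Set.univ).toReal * ∫ x, ∏ i ∈ Finset.range n, f i x ∂μ := by
  have := hμ.1
  have hf : ∀ i, i < n → IsSymmQuasiconcave (f i) := fun i hi =>
    ⟨hmeas i hi, hsymm i hi, hqc i hi⟩
  have hint : ∀ s : Finset ℕ, (∀ i ∈ s, i < n) →
      ∫ x, ∏ i ∈ s, f i x ∂μ = (∫⁻ x, ∏ i ∈ s, ENNReal.ofReal (f i x) ∂μ).toReal := by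
    intro s hs
    rw [integral_eq_lintegral_of_nonneg_ae
      (.of_forall fun x => Finset.prod_nonneg fun i hi => hnonneg i (hs i hi) x)
      (Finset.measurable_prod s fun i hi => hmeas i (hs i hi)).aestronglyMeasurable]
    congr 1
    refine lintegral_congr fun x => ?_
    exact ENNReal.ofReal_prod_of_nonneg fun i hi => hnonneg i (hs i hi) x
  have hfin : ∫⁻ x, ∏ i ∈ Finset.range n, ENNReal.ofReal (f i x) ∂μ ≠ ⊤ := by
    have hb : ∀ x, ∏ i ∈ Finset.range n, ENNReal.ofReal (f i x) ≤
        ∏ i ∈ Finset.range n, ENNReal.ofReal (f i 0) := fun x =>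
      Finset.prod_le_prod' fun i hi =>
        ENNReal.ofReal_le_ofReal ((hf i (Finset.mem_range.1 hi)).le_zero x)
    refine ((lintegral_mono hb).trans_lt ?_).ne
    rw [lintegral_const, measure_univ, mul_one]
    exact ENNReal.prod_lt_top fun i _ => ENNReal.ofReal_lt_top
  have key := hμ.correlatesSymmConvex.lintegral_prod_mul_le
    (f := fun i : Finset.range m => f i) (g := fun j : Finset.Ico m n => f j)
    (fun i => hf i ((Finset.mem_range.1 i.2).trans hmn)) (fun j => hf j (Finset.mem_Ico.1 j.2).2)
  have hr : ∀ (s : Finset ℕ) (x : X),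
      ∏ i : s, ENNReal.ofReal (f i x) = ∏ i ∈ s, ENNReal.ofReal (f i x) := fun s x =>
    Finset.prod_coe_sort s fun i => ENNReal.ofReal (f i x)
  simp only [hr, Finset.prod_range_mul_prod_Ico _ hmn.le] at key
  rw [measure_univ, ENNReal.toReal_one, one_mul,
    hint _ fun i hi => (Finset.mem_range.1 hi).trans hmn,
    hint _ fun i hi => (Finset.mem_Ico.1 hi).2, hint _ fun i hi => Finset.mem_range.1 hi,
    ← ENNReal.toReal_mul]
  exact ENNReal.toReal_mono hfin key
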